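/- arXiv:1708.02692 — 2 statements merged into one kernel-verified Lean document; each statement's English description precedes it below -/
import Mathlib

section
/- Let 𝒯 be a set of transpositions of Sym(n) whose transposition generating graph G(𝒯) is connected and has m ≥ 7 edges, and let G = Cay(Sym(n),𝒯). Suppose T is a set of vertices of G with |T| ≤ 2m−2 if G(𝒯) has no triangles and |T| ≤ 2m−3 if G(𝒯) has a triangle. Then one of the following holds: (1) G−T is connected; (2) G−T is disconnected with exactly two connected components, one of which is a single vertex; (3) G(𝒯) has no triangles, G−T is disconnected with exactly two connected components, one of which consists of a single edge on two vertices, and |T| = 2m−2; (4) G(𝒯) has no triangles, G−T is disconnected with exactly three connected components, two of which are single vertices, and |T| = 2m−2; (5) G(𝒯) has a triangle, G−T is disconnected with exactly three connected components, two of which are single vertices, and |T| = 2m−3. -/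
/-- The transposition generating graph `G(𝒯)` of a set `T` of transpositions of `Sym(n)`:
vertices `{1,…,n}` (modeled as `Fin n`), with an edge `i j` iff the transposition
`(i j)` belongs to `T`. -/
def transGraph {n : ℕ} (T : Set (Equiv.Perm (Fin n))) : SimpleGraph (Fin n) :=
  SimpleGraph.fromRel (fun i j => Equiv.swap i j ∈ T)

/-- The Cayley graph `Cay(Sym(n), T)`: vertices are permutations, and `g, h` are
adjacent iff `h = g * t` for some `t ∈ T`. -/
def cayley {n : ℕ} (T : Set (Equiv.Perm (Fin n))) : SimpleGraph (Equiv.Perm (Fin n)) :=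
  SimpleGraph.fromRel (fun g h => ∃ t ∈ T, h = g * t)

/-- `G` is a `k`-tree: there is a construction ordering of the vertices in which the
first `k+1` vertices are mutually adjacent, and each later vertex is joined to exactly
`k` mutually adjacent earlier vertices. -/
def IsKTree (k : ℕ) {V : Type*} [Fintype V] (G : SimpleGraph V) : Prop :=
  k + 1 ≤ Fintype.card V ∧
  ∃ e : Fin (Fintype.card V) ≃ V,
    (∀ i j : Fin (Fintype.card V), j < i → (i : ℕ) ≤ k → G.Adj (e i) (e j)) ∧
    ∀ i : Fin (Fintype.card V), k + 1 ≤ (i : ℕ) →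
      {j : Fin (Fintype.card V) | j < i ∧ G.Adj (e i) (e j)}.ncard = k ∧
      {j : Fin (Fintype.card V) | j < i ∧ G.Adj (e i) (e j)}.Pairwise
        (fun j₁ j₂ => G.Adj (e j₁) (e j₂))

/-- `F` is an `R_k`-vertex-cut of `G`: `G - F` is disconnected and every vertex of
`G - F` has at least `k` neighbors in `G - F`. -/
def IsRkCut {V : Type*} (G : SimpleGraph V) (k : ℕ) (F : Set V) : Prop :=
  ¬ (G.induce (Fᶜ : Set V)).Connected ∧
  ∀ v : V, v ∉ F → k ≤ {u : V | u ∉ F ∧ G.Adj v u}.ncard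

/-- The `R_k`-vertex-connectivity `κ^k(G)`: the minimum cardinality of an
`R_k`-vertex-cut of `G`. -/
noncomputable def rkConn {V : Type*} (G : SimpleGraph V) (k : ℕ) : ℕ :=
  sInf {m : ℕ | ∃ F : Set V, IsRkCut G k F ∧ F.ncard = m}

/-- A graph has a triangle if it has three mutually adjacent vertices. -/
def hasTriangle {V : Type*} (G : SimpleGraph V) : Prop :=
  ∃ a b c : V, G.Adj a b ∧ G.Adj a c ∧ G.Adj b c


namespace CL
open scoped Pointwise
variable {G : Type*} [Group G] [Fintype G] [DecidableEq G]

/-- open neighbourhood -/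
def nb (S A : Finset G) : Finset G := Finset.univ.filter (fun v => ∃ s ∈ S, v * s ∈ A)
/-- closed neighbourhood -/
def cl (S A : Finset G) : Finset G := A ∪ nb S A


lemma mem_cl {S A : Finset G} {v : G} : v ∈ cl S A ↔ v ∈ A ∨ ∃ s ∈ S, v * s ∈ A := by
  simp [cl, nb]

lemma subset_cl (S A : Finset G) : A ⊆ cl S A := Finset.subset_union_left

lemma cl_mono (S : Finset G) {A B : Finset G} (h : A ⊆ B) : cl S A ⊆ cl S B := by
  intro v; rw [mem_cl, mem_cl]; rintro (h1 | ⟨s, hs, h1⟩)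
  · exact Or.inl (h h1)
  · exact Or.inr ⟨s, hs, h h1⟩

lemma cl_union (S A B : Finset G) : cl S (A ∪ B) = cl S A ∪ cl S B := by
  ext v; simp only [mem_cl, Finset.mem_union]; grind

lemma cl_smul (S A : Finset G) (g : G) : cl S (g • A) = g • cl S A := by
  ext v
  simp only [mem_cl, ← Finset.inv_smul_mem_iff, smul_eq_mul, mul_assoc]

lemma cl_submod (S A B : Finset G) :
    (cl S (A ∩ B)).card + (cl S (A ∪ B)).card ≤ (cl S A).card + (cl S B).card := by
  rw [cl_union, ← Finset.card_union_add_card_inter (cl S A) (cl S B), add_comm]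
  have : cl S (A ∩ B) ⊆ cl S A ∩ cl S B :=
    Finset.subset_inter (cl_mono S Finset.inter_subset_left) (cl_mono S Finset.inter_subset_right)
  have := Finset.card_le_card this
  omega

/-- a fragment candidate -/
def Frag (S A : Finset G) : Prop := 3 ≤ A.card ∧ (cl S A).card + 3 ≤ Fintype.card G

lemma exists_atom (S A₀ : Finset G) (h₀ : Frag S A₀) :
    ∃ A, Frag S A ∧ (cl S A).card + A₀.card ≤ (cl S A₀).card + A.card ∧
      ∀ B, Frag S B → (cl S A).card + B.card < (cl S B).card + A.card ∨
        ((cl S A).card + B.card = (cl S B).card + A.card ∧ A.card ≤ B.card) := by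
  classical
  have key : ∀ B : Finset G, B.card ≤ (cl S B).card := fun B => Finset.card_le_card (subset_cl S B)
  have key2 : ∀ B : Finset G, B.card ≤ Fintype.card G := fun B => Finset.card_le_univ B
  obtain ⟨A, hA, hmin⟩ := Finset.exists_min_image
    (Finset.univ.filter (fun B : Finset G => Frag S B))
    (fun B => ((cl S B).card - B.card) * (Fintype.card G + 1) + B.card) ⟨A₀, by simpa using h₀⟩
  simp only [Finset.mem_filter, Finset.mem_univ, true_and] at hA hmin
  have main : ∀ B, Frag S B → (cl S A).card + B.card < (cl S B).card + A.card ∨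
        ((cl S A).card + B.card = (cl S B).card + A.card ∧ A.card ≤ B.card) := by
    intro B hB
    have h := hmin B hB
    have k1 := key A; have k2 := key B; have k3 := key2 A; have k4 := key2 B
    obtain ⟨p, hp⟩ := Nat.exists_eq_add_of_le k1
    obtain ⟨q, hq⟩ := Nat.exists_eq_add_of_le k2
    rw [hp, hq] at h
    simp only [Nat.add_sub_cancel_left] at h
    rcases lt_trichotomy p q with h1 | h1 | h1
    · left; omega
    · right; subst h1; omega
    · exfalso
      have : (q + 1) * (Fintype.card G + 1) ≤ p * (Fintype.card G + 1) := Nat.mul_le_mul_right _ h1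
      nlinarith
  refine ⟨A, hA, ?_, main⟩
  rcases main A₀ h₀ with h | h <;> omega

/-- The atom property -/
structure Atom (S A : Finset G) : Prop where
  frag : Frag S A
  min : ∀ B, Frag S B → (cl S A).card + B.card < (cl S B).card + A.card ∨
        ((cl S A).card + B.card = (cl S B).card + A.card ∧ A.card ≤ B.card)

lemma Atom.two_mul {S A : Finset G} (hinv : ∀ s ∈ S, s * s = 1) (h : Atom S A) :
    A.card + (cl S A).card ≤ Fintype.card G := by
  have hsub : cl S (cl S A)ᶜ ⊆ Aᶜ := by
    intro v hv
    rw [mem_cl] at hv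
    rw [Finset.mem_compl]
    intro hvA
    rcases hv with hv | ⟨s, hs, hv⟩
    · exact (Finset.mem_compl.1 hv) (subset_cl S A hvA)
    · refine (Finset.mem_compl.1 hv) (mem_cl.2 (Or.inr ⟨s, hs, ?_⟩))
      rw [mul_assoc, hinv s hs, mul_one]; exact hvA
  have h1 := Finset.card_le_card hsub
  have h2 := Finset.card_compl A
  have h3 := Finset.card_compl (cl S A)
  have h4 := Finset.card_le_univ A
  have h5 := Finset.card_le_univ (cl S A)
  obtain ⟨ha, hb⟩ := h.frag
  have : Frag S (cl S A)ᶜ := ⟨by omega, by omega⟩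
  rcases h.min _ this with h6 | h6 <;> omega

lemma Atom.inter {S A : Finset G} (hinv : ∀ s ∈ S, s * s = 1) (h : Atom S A) (g : G)
    (hg : 3 ≤ (A ∩ g • A).card) : g • A = A := by
  by_contra hne
  have h2 := h.two_mul hinv
  have hsub := cl_submod S A (g • A)
  have hc1 : (g • A).card = A.card := Finset.card_smul_finset g A
  have hc2 : (cl S (g • A)).card = (cl S A).card := by rw [cl_smul, Finset.card_smul_finset]
  have hlt : (A ∩ g • A).card < A.card := by
    refine Finset.card_lt_card ⟨Finset.inter_subset_left, fun hh => hne ?_⟩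
    have : A ⊆ g • A := fun x hx => (Finset.mem_inter.1 (hh hx)).2
    exact (Finset.eq_of_subset_of_card_le this hc1.le).symm
  have hcap : Frag S (A ∩ g • A) := by
    refine ⟨hg, ?_⟩
    have := Finset.card_le_card (cl_mono S (Finset.inter_subset_left (s₁ := A) (s₂ := g • A)))
    have := h.frag.2
    omega
  have hui := Finset.card_union_add_card_inter A (g • A)
  have hcup : Frag S (A ∪ g • A) := by
    refine ⟨?_, ?_⟩
    · have := h.frag.1
      omega
    · rcases h.min _ hcap with h6 | h6 <;> omega
  rcases h.min _ hcap with h6 | h6 <;> rcases h.min _ hcup with h7 | h7 <;> omega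

lemma Atom.nbr {S A : Finset G} (h : Atom S A) (hA : 4 ≤ A.card) (x : G) (hx : x ∈ A) :
    ∃ s ∈ S, x * s ∈ A := by
  have hc : (A.erase x).card = A.card - 1 := Finset.card_erase_of_mem hx
  have hs := cl_mono S (Finset.erase_subset x A)
  have hs' := Finset.card_le_card hs
  have hf : Frag S (A.erase x) := ⟨by omega, by have := h.frag.2; omega⟩
  have heq : cl S (A.erase x) = cl S A :=
    Finset.eq_of_subset_of_card_le hs (by rcases h.min _ hf with h6 | h6 <;> omega)
  have : x ∈ cl S (A.erase x) := by rw [heq]; exact subset_cl S A hx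
  rcases mem_cl.1 this with h1 | ⟨s, hs, h1⟩
  · simp at h1
  · exact ⟨s, hs, Finset.mem_of_mem_erase h1⟩

lemma card_dvd_of_smul {K : Subgroup G} {X : Finset G} (h : ∀ g ∈ K, g • X = X) :
    Nat.card K ∣ X.card := by
  classical
  have : ∀ g : K, ∀ x ∈ X, (g : G) * x ∈ X := by
    intro g x hx
    rw [← h g g.2]; exact Finset.smul_mem_smul_finset hx
  let act : MulAction K X :=
    { smul := fun g x => ⟨(g : G) * x, this g x x.2⟩
      one_smul := fun x => Subtype.ext (one_mul _)
      mul_smul := fun g g' x => Subtype.ext (mul_assoc _ _ _) }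
  have hfree : ∀ x : X, MulAction.stabilizer K x = ⊥ := by
    intro x
    rw [eq_bot_iff]
    intro g hg
    have h1 : (g : G) * x = x := congrArg Subtype.val (MulAction.mem_stabilizer_iff.1 hg)
    have h2 : (g : G) = 1 := by simpa using h1
    exact Subgroup.mem_bot.2 (Subtype.ext h2)
  have e := MulAction.selfEquivSigmaOrbitsQuotientStabilizer K X
  have := Nat.card_congr e
  rw [Nat.card_sigma] at this
  have h3 : ∀ ω : MulAction.orbitRel.Quotient K X,
      Nat.card (K ⧸ MulAction.stabilizer K (Quotient.out ω)) = Nat.card K := by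
    intro ω
    rw [hfree]
    exact Nat.card_congr QuotientGroup.quotientBot.toEquiv
  have h4 : Nat.card X = X.card := by simp
  rw [← h4, this]
  exact Finset.dvd_sum (fun ω _ => (h3 ω) ▸ dvd_rfl)

end CL


namespace CL
open scoped Pointwise
variable {G : Type*} [Group G] [Fintype G] [DecidableEq G]

/-- degree into `A` -/
def dg (S A : Finset G) (v : G) : ℕ := (S.filter (fun s => v * s ∈ A)).card
/-- number of representations as a product of two generators -/
def rep (S : Finset G) (g : G) : ℕ := (S.filter (fun s => s⁻¹ * g ∈ S)).card

lemma dg_eq_zero {S A : Finset G} {v : G} (h : v ∉ nb S A) : dg S A v = 0 := by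
  unfold dg
  rw [Finset.card_eq_zero, Finset.filter_eq_empty_iff]
  intro s hs hv
  exact h (by simp only [nb, Finset.mem_filter, Finset.mem_univ, true_and]; exact ⟨s, hs, hv⟩)

lemma sum_sub {S A U : Finset G} (hU : nb S A ⊆ U) (f : ℕ → ℕ) (hf : f 0 = 0) :
    ∑ v ∈ U, f (dg S A v) = ∑ v, f (dg S A v) := by
  refine Finset.sum_subset (Finset.subset_univ U) (fun v _ hv => ?_)
  rw [dg_eq_zero (fun h => hv (hU h)), hf]

lemma card_shift (A : Finset G) (s : G) :
    (Finset.univ.filter (fun v => v * s ∈ A)).card = A.card := by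
  refine Finset.card_bij (fun v _ => v * s) ?_ ?_ ?_
  · intro v hv; simpa using hv
  · intro v _ w _ h; simpa using h
  · intro b hb; exact ⟨b * s⁻¹, by simpa using hb, by simp⟩

lemma sum_dg (S A : Finset G) : ∑ v, dg S A v = S.card * A.card := by
  have : ∀ v, dg S A v = ∑ s ∈ S, if v * s ∈ A then 1 else 0 := by
    intro v; rw [dg, Finset.card_filter]
  simp_rw [this]
  rw [Finset.sum_comm]
  have : ∀ s ∈ S, (∑ v : G, if v * s ∈ A then 1 else 0) = A.card := by
    intro s _; rw [← Finset.card_filter]; exact card_shift A s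
  rw [Finset.sum_congr rfl this]; simp

lemma sum_dg_sq (S A : Finset G) (hinv : ∀ s ∈ S, s * s = 1) :
    ∑ v, dg S A v ^ 2 = ∑ x ∈ A, ∑ y ∈ A, rep S (x⁻¹ * y) := by
  have e1 : ∀ v, dg S A v ^ 2 = ∑ s ∈ S, ∑ t ∈ S, if v * s ∈ A ∧ v * t ∈ A then 1 else 0 := by
    intro v
    rw [sq, dg, Finset.card_filter, Finset.sum_mul_sum]
    refine Finset.sum_congr rfl fun s _ => Finset.sum_congr rfl fun t _ => ?_
    by_cases h1 : v * s ∈ A <;> by_cases h2 : v * t ∈ A <;> simp [h1, h2]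
  have e2 : ∀ x y, rep S (x⁻¹ * y) = ∑ s ∈ S, ∑ t ∈ S, if x * s * t = y then 1 else 0 := by
    intro x y
    rw [rep, Finset.card_filter]
    refine Finset.sum_congr rfl fun s _ => ?_
    have : ∀ t, (x * s * t = y) ↔ (t = s⁻¹ * (x⁻¹ * y)) := by
      intro t; constructor
      · rintro rfl; group
      · rintro rfl; group
    simp_rw [this]
    rw [Finset.sum_ite_eq']
  simp_rw [e1, e2]
  rw [Finset.sum_comm]
  have e3 : ∀ x ∈ A, (∑ y ∈ A, ∑ s ∈ S, ∑ t ∈ S, if x * s * t = y then 1 else 0)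
      = ∑ s ∈ S, ∑ t ∈ S, if x * s * t ∈ A then 1 else 0 := by
    intro x _
    rw [Finset.sum_comm]
    refine Finset.sum_congr rfl fun s _ => ?_
    rw [Finset.sum_comm]
    refine Finset.sum_congr rfl fun t _ => ?_
    rw [Finset.sum_ite_eq]
  rw [Finset.sum_congr rfl e3, Finset.sum_comm (s := A)]
  refine Finset.sum_congr rfl fun s hs => ?_
  rw [Finset.sum_comm, Finset.sum_comm (s := A)]
  refine Finset.sum_congr rfl fun t _ => ?_
  rw [← Finset.card_filter, ← Finset.card_filter]
  refine Finset.card_bij (fun v _ => v * s) ?_ ?_ ?_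
  · intro v hv
    simp only [Finset.mem_filter, Finset.mem_univ, true_and] at hv ⊢
    refine ⟨hv.1, ?_⟩
    rw [mul_assoc v s s, hinv s hs, mul_one]; exact hv.2
  · intro v _ w _ h; simpa using h
  · intro b hb
    simp only [Finset.mem_filter, Finset.mem_univ, true_and] at hb ⊢
    exact ⟨b * s, ⟨by rw [mul_assoc, hinv s hs, mul_one]; exact hb.1, hb.2⟩,
      by rw [mul_assoc, hinv s hs, mul_one]⟩

/-- second moment bound, in presence of a subgroup `P` preserving `A`. -/
lemma second_moment {S A : Finset G} (hinv : ∀ s ∈ S, s * s = 1) {c : ℕ}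
    (hr : ∀ g, g ≠ 1 → rep S g ≤ c) (h6 : ∀ s ∈ S, ∀ t ∈ S, (s * t) ^ 6 = 1)
    (P : Subgroup G) (hP : (Nat.card P).Coprime 6) (hPA : ∀ g ∈ P, ∀ x ∈ A, g * x ∈ A) :
    S.card ^ 2 * A.card ≤ (nb S A).card * (S.card + c * (A.card - Nat.card P)) := by
  classical
  have hx : ∀ x ∈ A, ∑ y ∈ A, rep S (x⁻¹ * y) ≤ S.card + c * (A.card - Nat.card P) := by
    intro x hx
    set Y : Finset G := (Finset.univ.filter (fun g => g ∈ P)).image (fun g => g * x) with hY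
    have hYA : Y ⊆ A := by
      intro y hy
      simp only [hY, Finset.mem_image, Finset.mem_filter, Finset.mem_univ, true_and] at hy
      obtain ⟨g, hg, rfl⟩ := hy
      exact hPA g hg x hx
    have hYc : Y.card = Nat.card P := by
      rw [hY, Finset.card_image_of_injective _ (mul_left_injective x)]
      rw [Nat.card_eq_fintype_card, Fintype.card_subtype]
    have hxY : x ∈ Y := by
      simp only [hY, Finset.mem_image, Finset.mem_filter, Finset.mem_univ, true_and]
      exact ⟨1, P.one_mem, one_mul x⟩
    rw [← Finset.sum_sdiff hYA]
    have h1 : ∑ y ∈ A \ Y, rep S (x⁻¹ * y) ≤ c * (A.card - Nat.card P) := by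
      rw [← hYc, ← Finset.card_sdiff_of_subset hYA, mul_comm, ← smul_eq_mul]
      refine Finset.sum_le_card_nsmul _ _ _ (fun y hy => hr _ ?_)
      intro h
      have : x = y := by rwa [inv_mul_eq_one] at h
      exact (Finset.mem_sdiff.1 hy).2 (this ▸ hxY)
    have h2 : ∑ y ∈ Y, rep S (x⁻¹ * y) ≤ S.card := by
      rw [Finset.sum_eq_single_of_mem x hxY]
      · exact Finset.card_filter_le _ _
      · intro y hy hne
        rw [rep, Finset.card_eq_zero, Finset.filter_eq_empty_iff]
        intro s hs hst
        simp only [hY, Finset.mem_image, Finset.mem_filter, Finset.mem_univ, true_and] at hy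
        obtain ⟨g, hg, rfl⟩ := hy
        have a6 := h6 s hs _ hst
        rw [mul_inv_cancel_left] at a6
        have b6 : g ^ 6 = 1 := by
          have : (x⁻¹ * (g * x)) ^ 6 = x⁻¹ * g ^ 6 * x := by
            have := conj_pow (i := 6) (a := x⁻¹) (b := g)
            rw [inv_inv] at this
            rw [← this, mul_assoc]
          rw [this] at a6
          have : g ^ 6 = x * (x⁻¹ * g ^ 6 * x) * x⁻¹ := by group
          rw [this, a6]; group
        have bp : g ^ Nat.card P = 1 := by
          have := pow_card_eq_one' (G := P) (x := ⟨g, hg⟩)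
          have := congrArg Subtype.val this
          rwa [Subgroup.coe_pow, Subgroup.coe_one] at this
        have : g = 1 := by
          rw [← orderOf_eq_one_iff, ← Nat.dvd_one, ← hP]
          exact Nat.dvd_gcd (orderOf_dvd_of_pow_eq_one bp) (orderOf_dvd_of_pow_eq_one b6)
        exact hne (by rw [this, one_mul])
    omega
  have hsq : ∑ v ∈ nb S A, dg S A v ^ 2 ≤ A.card * (S.card + c * (A.card - Nat.card P)) := by
    rw [sum_sub subset_rfl (fun d => d ^ 2) rfl, sum_dg_sq S A hinv, ← smul_eq_mul]
    exact Finset.sum_le_card_nsmul _ _ _ hx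
  have hcs := sq_sum_le_card_mul_sum_sq (s := nb S A) (f := dg S A)
  rw [sum_sub subset_rfl (fun d => d) rfl, sum_dg] at hcs
  rcases Nat.eq_zero_or_pos A.card with h0 | h0
  · simp [h0]
  have := hcs.trans (Nat.mul_le_mul_left _ hsq)
  have e : A.card * (S.card ^ 2 * A.card) ≤
      A.card * ((nb S A).card * (S.card + c * (A.card - Nat.card P))) := by
    calc _ = (S.card * A.card) ^ 2 := by ring
      _ ≤ _ := this
      _ = _ := by rw [Nat.cast_id]; ring
  exact Nat.le_of_mul_le_mul_left e h0

lemma third_count {S A : Finset G} (h : ∀ g : G, 3 ≤ (A ∩ g • A).card → g • A = A) :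
    ∑ v, (dg S A v).choose 3 ≤ S.card.choose 3 * Nat.card (MulAction.stabilizer G A) := by
  classical
  have e1 : ∀ v, (dg S A v).choose 3 =
      ∑ U ∈ S.powersetCard 3, if ∀ s ∈ U, v * s ∈ A then 1 else 0 := by
    intro v
    rw [dg, ← Finset.card_powersetCard, ← Finset.card_filter]
    congr 1
    ext U
    simp only [Finset.mem_powersetCard, Finset.mem_filter, Finset.subset_iff]
    grind
  simp_rw [e1]
  rw [Finset.sum_comm, ← Finset.card_powersetCard, ← smul_eq_mul]
  refine Finset.sum_le_card_nsmul _ _ _ (fun U hU => ?_)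
  rw [← Finset.card_filter]
  obtain ⟨_, hU3⟩ := Finset.mem_powersetCard.1 hU
  rcases (Finset.univ.filter (fun v => ∀ s ∈ U, v * s ∈ A)).eq_empty_or_nonempty with h0 | ⟨v, hv⟩
  · rw [h0]; simp
  rw [Nat.card_eq_fintype_card, Fintype.card_subtype]
  simp only [Finset.mem_filter, Finset.mem_univ, true_and] at hv
  refine Finset.card_le_card_of_injOn (fun w => w * v⁻¹) ?_ ?_
  · intro w hw
    simp only [Finset.coe_filter, Finset.mem_univ, true_and, Set.mem_ofPred_eq] at hw ⊢
    rw [MulAction.mem_stabilizer_iff]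
    apply h
    rw [← hU3, ← Finset.card_image_of_injective U (mul_right_injective w)]
    apply Finset.card_le_card
    intro y hy
    obtain ⟨s, hs, rfl⟩ := Finset.mem_image.1 hy
    refine Finset.mem_inter.2 ⟨hw s hs, ?_⟩
    have : w * s = (w * v⁻¹) • (v * s) := by simp [mul_assoc]
    rw [this]
    exact Finset.smul_mem_smul_finset (hv s hs)
  · intro a _ b _ hab
    simpa using hab

/-- third moment, real form -/
lemma third_real {S A : Finset G} (h : ∀ g : G, 3 ≤ (A ∩ g • A).card → g • A = A)
    (α β : ℝ) (hab : ∀ d : ℕ, α * d - β ≤ (d : ℝ) * (d - 1) * (d - 2)) :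
    α * (S.card * A.card) ≤ β * (cl S A).card +
      Nat.card (MulAction.stabilizer G A) * (S.card * (S.card - 1) * (S.card - 2)) := by
  have ch : ∀ d : ℕ, (d : ℝ) * (d - 1) * (d - 2) = 6 * (d.choose 3 : ℕ) := by
    intro d
    have h1 := Nat.descFactorial_eq_factorial_mul_choose d 3
    rcases d with _ | _ | _ | d
    · simp
    · simp [Nat.choose]
    · norm_num
    · simp [Nat.descFactorial, Nat.factorial] at h1
      have h2 : ((d + 1 : ℝ) * ((d + 2) * (d + 3))) = 6 * ((d + 3).choose 3 : ℕ) := by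
        exact_mod_cast h1
      push_cast at h2 ⊢
      linarith
  have hsub : nb S A ⊆ cl S A := Finset.subset_union_right
  have s1 : ∑ v ∈ cl S A, ((dg S A v : ℕ) : ℝ) = S.card * A.card := by
    have := sum_sub hsub (fun d => d) rfl
    rw [sum_dg] at this
    exact_mod_cast this
  have s3 : ∑ v ∈ cl S A, (((dg S A v).choose 3 : ℕ) : ℝ) ≤
      (S.card.choose 3 : ℕ) * Nat.card (MulAction.stabilizer G A) := by
    have := sum_sub hsub (fun d => d.choose 3) rfl
    have h3 := third_count (S := S) h
    rw [← this] at h3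
    exact_mod_cast h3
  have key : ∑ v ∈ cl S A, (α * (dg S A v : ℝ) - β) ≤
      ∑ v ∈ cl S A, 6 * (((dg S A v).choose 3 : ℕ) : ℝ) :=
    Finset.sum_le_sum fun v _ => (hab _).trans (ch _).le
  rw [Finset.sum_sub_distrib, ← Finset.mul_sum, ← Finset.mul_sum, s1, Finset.sum_const,
    nsmul_eq_mul] at key
  rw [ch]
  linarith

end CL


namespace CL
open scoped Pointwise

/-- third moment test -/
def chk3 (m κ k a : ℕ) : Bool :=
  let N := Nat.add a κ
  let j := Nat.div (Nat.mul m a) N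
  let q := Nat.mul j (Nat.sub j 1)
  Nat.ble (Nat.mul (Nat.mul 3 q) (Nat.mul m a)) (Nat.add (Nat.mul (Nat.mul (Nat.mul 2 q) (Nat.succ j)) N)
     (Nat.mul k (Nat.mul (Nat.mul m (Nat.sub m 1)) (Nat.sub m 2))))

/-- second moment test -/
def chk2 (m c κ a0 a1 : ℕ) : Bool :=
  let D0 := Nat.add m (Nat.mul c (Nat.sub a0 1))
  let D1 := Nat.add m (Nat.mul c (Nat.sub a1 1))
  let n0 := Nat.div (Nat.sub (Nat.add (Nat.mul (Nat.mul m m) a0) D0) 1) D0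
  let n1 := Nat.div (Nat.sub (Nat.add (Nat.mul (Nat.mul m m) a1) D1) 1) D1
  (Nat.ble n0 (Nat.add a1 κ)).and ((Nat.ble n1 (Nat.add a0 κ)).and (Nat.ble (Nat.add n0 n1) (Nat.add (Nat.add a0 a1) κ)))

/-- all below -/
def allb (p : ℕ → Bool) : ℕ → Bool := fun n => Nat.rec true (fun k b => (p k).rec false b) n

lemma allb_iff (p : ℕ → Bool) (n : ℕ) : allb p n = true ↔ ∀ k, k < n → p k = true := by
  induction n with
  | zero => simp [allb]
  | succ n ih =>
    have : allb p (n + 1) = (p n).rec false (allb p n) := rfl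
    rw [this]
    cases h : p n with
    | false => simpa using ⟨n, by omega, h⟩
    | true =>
      change allb p n = true ↔ _
      rw [ih]
      constructor
      · intro hh k hk
        rcases Nat.lt_succ_iff_lt_or_eq.1 hk with h' | rfl
        · exact hh k h'
        · exact h
      · intro hh k hk
        exact hh k (by omega)

lemma fin_big2 : allb (fun m => (Nat.ble m 9).or (allb (fun a => (Nat.ble a 3).or
    ((chk3 m (Nat.sub (Nat.mul 2 m) 2) (Nat.sub (Nat.mul 2 m) 2) a).not.or
    (allb (fun a0 => (Nat.ble a0 0).or
      (chk2 m 2 (Nat.sub (Nat.mul 2 m) 2) a0 (Nat.sub a a0)).not)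
      (Nat.succ (Nat.div a 2))))) (Nat.succ (Nat.mul 5 m)))) 15 = true := by
  decide +kernel

lemma fin_big3 : allb (fun m => (Nat.ble m 9).or (allb (fun a => (Nat.ble a 3).or
    ((chk3 m (Nat.sub (Nat.mul 2 m) 3) (Nat.sub (Nat.mul 2 m) 3) a).not.or
    (allb (fun a0 => (Nat.ble a0 0).or
      (chk2 m 3 (Nat.sub (Nat.mul 2 m) 3) a0 (Nat.sub a a0)).not)
      (Nat.succ (Nat.div a 2))))) (Nat.succ (Nat.mul 5 m)))) 15 = true := by
  decide +kernel

lemma fin_small2 : allb (fun m => (Nat.ble m 6).or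
    (allb (fun κ => (Nat.ble κ 0).or
    (allb (fun k => (Nat.ble 1 (Nat.mod κ k)).or
    (allb (fun a => (Nat.ble a 3).or ((Nat.ble 1 (Nat.mod a k)).or
    ((chk3 m κ k a).not.or
    (allb (fun a0 => (Nat.ble a0 0).or
      (chk2 m 2 κ a0 (Nat.sub a a0)).not)
      (Nat.succ (Nat.div a 2))))))
    (Nat.succ (Nat.mul 5 m)))) (Nat.succ κ))) (Nat.sub (Nat.succ (Nat.mul 2 m)) 2))) 10 = true := by
  decide +kernel

lemma fin_small3 : allb (fun m => (Nat.ble m 6).or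
    (allb (fun κ => (Nat.ble κ 0).or
    (allb (fun k => (Nat.ble 1 (Nat.mod κ k)).or
    (allb (fun a => (Nat.ble a 3).or ((Nat.ble 1 (Nat.mod a k)).or
    ((chk3 m κ k a).not.or
    (allb (fun a0 => (Nat.ble a0 0).or
      ((chk2 m 3 κ a0 (Nat.sub a a0)).not.or ((Nat.beq κ k).and ((Nat.beq a (Nat.mul 2 k)).and
      (((Nat.beq m 7).and (Nat.beq k 10)).or (((Nat.beq m 7).and (Nat.beq k 11)).or
        ((Nat.beq m 8).and (Nat.beq k 13))))))))
      (Nat.succ (Nat.div a 2))))))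
    (Nat.succ (Nat.mul 5 m)))) (Nat.succ κ))) (Nat.sub (Nat.succ (Nat.mul 2 m)) 3))) 10 = true := by
  decide +kernel

lemma num_large (m c a0 a1 N0 N1 : ℕ) (hc : c ≤ 3) (hm : 15 ≤ m) (h0 : 1 ≤ a0) (h01 : a0 ≤ a1)
    (h4 : 4 ≤ a0 + a1) (h5 : a0 + a1 ≤ 5 * m) (hm0 : m ≤ N0)
    (f1 : m ^ 2 * a1 ≤ N1 * (m + c * (a1 - 1))) (hN0 : a1 ≤ N0)
    (hN : N0 + N1 + 2 ≤ a0 + a1 + 2 * m) : False := by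
  have f2 : m ^ 2 * a1 ≤ N1 * (m + 3 * (a1 - 1)) :=
    f1.trans (Nat.mul_le_mul_left _ (Nat.add_le_add_left (Nat.mul_le_mul_right _ hc) _))
  obtain ⟨t, rfl⟩ : ∃ t, a1 = t + 1 := ⟨a1 - 1, by omega⟩
  rw [Nat.add_sub_cancel] at f2
  zify at *
  have hE : (0 : ℤ) ≤ m + 3 * t := by positivity
  rcases le_total (t + 1 : ℤ) m with h | h
  · have : (N1 : ℤ) ≤ 2 * t + m := by linarith
    have := mul_le_mul_of_nonneg_right this hE
    have t1 : (1 : ℤ) ≤ t := by linarith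
    have h6 : (6 : ℤ) * t + 5 * m < m ^ 2 := by nlinarith
    nlinarith [mul_pos (by linarith : (0 : ℤ) < t) (sub_pos.2 h6)]
  · rcases le_total (2 * (t + 1) : ℤ) (5 * m) with h' | h'
    · have : (N1 : ℤ) ≤ t + 2 * m - 1 := by linarith
      have := mul_le_mul_of_nonneg_right this hE
      nlinarith [mul_nonneg (sub_nonneg.2 h) (sub_nonneg.2 h'), mul_nonneg (sub_nonneg.2 h) (sub_nonneg.2 hm),
         mul_nonneg (sub_nonneg.2 h') (sub_nonneg.2 hm), mul_nonneg (mul_nonneg (sub_nonneg.2 h') (sub_nonneg.2 hm)) (sub_nonneg.2 hm), mul_nonneg (mul_nonneg (sub_nonneg.2 h) (sub_nonneg.2 hm)) (sub_nonneg.2 hm)]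
    · have : (2 * N1 : ℤ) ≤ 9 * m - 4 := by linarith
      have := mul_le_mul_of_nonneg_right this hE
      have h6 : (0 : ℤ) ≤ 2 * m ^ 2 - 27 * m + 12 := by nlinarith
      nlinarith [mul_nonneg (sub_nonneg.2 h') h6, mul_nonneg (sub_nonneg.2 hm) (sub_nonneg.2 hm),
        mul_nonneg (mul_nonneg (sub_nonneg.2 hm) (sub_nonneg.2 hm)) (sub_nonneg.2 hm)]

lemma ceil_le {X D N : ℕ} (hD : 0 < D) (h : X ≤ N * D) : (X + D - 1) / D ≤ N := by
  have : X + D - 1 < (N + 1) * D := by rw [add_mul, one_mul]; omega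
  have := (Nat.div_lt_iff_lt_mul hD).2 this
  omega

lemma chk3_true (m κ k a : ℕ)
    (h3 : ∀ j : ℕ, 3 * (j * (j - 1)) * (m * a) ≤
      2 * (j * (j - 1)) * (j + 1) * (a + κ) + k * (m * (m - 1) * (m - 2))) :
    chk3 m κ k a = true := by
  exact Nat.ble_eq_true_of_le (h3 _)

lemma chk2_true (m c κ a0 a1 N0 N1 : ℕ) (hm : 7 ≤ m)
    (f0 : m ^ 2 * a0 ≤ N0 * (m + c * (a0 - 1))) (f1 : m ^ 2 * a1 ≤ N1 * (m + c * (a1 - 1)))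
    (hN0 : a1 ≤ N0) (hN1 : a0 ≤ N1) (hN : N0 + N1 ≤ a0 + a1 + κ) :
    chk2 m c κ a0 a1 = true := by
  rw [pow_two] at f0 f1
  have e0 := ceil_le (by omega) f0
  have e1 := ceil_le (by omega) f1
  have g0 : (m * m * a0 + (m + c * (a0 - 1)) - 1) / (m + c * (a0 - 1)) ≤ a1 + κ := by omega
  have g1 : (m * m * a1 + (m + c * (a1 - 1)) - 1) / (m + c * (a1 - 1)) ≤ a0 + κ := by omega
  exact Bool.and_eq_true_iff.2 ⟨Nat.ble_eq_true_of_le g0, Bool.and_eq_true_iff.2 ⟨Nat.ble_eq_true_of_le g1,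
    Nat.ble_eq_true_of_le ((Nat.add_le_add e0 e1).trans hN)⟩⟩

lemma num (m c κ K k a0 a1 N0 N1 : ℕ) (hm : 7 ≤ m)
    (hc : (c = 2 ∧ K = 2 * m - 2) ∨ (c = 3 ∧ K = 2 * m - 3))
    (hκ : 1 ≤ κ) (hκK : κ ≤ K) (hk1 : k ∣ κ) (hk2 : k ∣ a0 + a1)
    (h0 : 1 ≤ a0) (h01 : a0 ≤ a1) (h4 : 4 ≤ a0 + a1) (h5 : a0 + a1 ≤ 5 * m) (hm0 : m ≤ N0)
    (f0 : m ^ 2 * a0 ≤ N0 * (m + c * (a0 - 1))) (f1 : m ^ 2 * a1 ≤ N1 * (m + c * (a1 - 1)))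
    (hN0 : a1 ≤ N0) (hN1 : a0 ≤ N1) (hN : N0 + N1 ≤ a0 + a1 + κ)
    (h3 : ∀ j : ℕ, 3 * (j * (j - 1)) * (m * (a0 + a1)) ≤
      2 * (j * (j - 1)) * (j + 1) * (a0 + a1 + κ) + k * (m * (m - 1) * (m - 2))) :
    c = 3 ∧ κ = k ∧ a0 + a1 = 2 * k ∧ (m = 7 ∧ k = 10 ∨ m = 7 ∧ k = 11 ∨ m = 8 ∧ k = 13) := by
  have hkκ : k ≤ κ := Nat.le_of_dvd hκ hk1
  rcases Nat.lt_or_ge m 15 with h15 | h15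
  swap
  · exact (num_large m c a0 a1 N0 N1 (by omega) h15 h0 h01 h4 h5 hm0 f1 hN0 (by omega)).elim
  have hsub : a0 + a1 - a0 = a1 := by omega
  rcases Nat.lt_or_ge m 10 with h10 | h10
  · have hch3 := chk3_true m κ k (a0 + a1) h3
    have hch2 := chk2_true m c κ a0 a1 N0 N1 hm f0 f1 hN0 hN1 hN
    rcases hc with ⟨rfl, rfl⟩ | ⟨rfl, rfl⟩
    · exfalso
      have := fin_small2
      simp only [allb_iff, Bool.or_eq_true, Nat.ble_eq, Bool.not_eq_true', Nat.succ_eq_add_one,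
        Nat.mul_eq, Nat.sub_eq, Bool.and_eq_true, Nat.beq_eq] at this
      have := (this m h10).resolve_left (by omega) κ (by omega)
      have := this.resolve_left (by omega) k (by omega)
      have := this.resolve_left (by have : Nat.mod κ k = 0 := Nat.mod_eq_zero_of_dvd hk1; omega) (a0 + a1) (by omega)
      rcases this with h | h | h | h
      · omega
      · have : Nat.mod (a0 + a1) k = 0 := Nat.mod_eq_zero_of_dvd hk2
        omega
      · rw [hch3] at h; cases h
      · rcases h a0 (by change a0 < (a0 + a1) / 2 + 1; omega) with h | h
        · omega
        · rw [hsub, hch2] at h; cases h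
    · refine ⟨rfl, ?_⟩
      have := fin_small3
      simp only [allb_iff, Bool.or_eq_true, Nat.ble_eq, Bool.not_eq_true', Nat.succ_eq_add_one,
        Nat.mul_eq, Nat.sub_eq, Bool.and_eq_true, Nat.beq_eq] at this
      have := (this m h10).resolve_left (by omega) κ (by omega)
      have := this.resolve_left (by omega) k (by omega)
      have := this.resolve_left (by have : Nat.mod κ k = 0 := Nat.mod_eq_zero_of_dvd hk1; omega) (a0 + a1) (by omega)
      rcases this with h | h | h | h
      · omega
      · have : Nat.mod (a0 + a1) k = 0 := Nat.mod_eq_zero_of_dvd hk2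
        omega
      · rw [hch3] at h; cases h
      · rcases h a0 (by change a0 < (a0 + a1) / 2 + 1; omega) with h | h | h
        · omega
        · rw [hsub, hch2] at h; cases h
        · exact h
  · exfalso
    have hch3 := chk3_true m K K (a0 + a1)
      (fun j => (h3 j).trans (Nat.add_le_add (Nat.mul_le_mul_left _ (by omega))
        (Nat.mul_le_mul_right _ (by omega))))
    have hch2 := chk2_true m c K a0 a1 N0 N1 hm f0 f1 hN0 hN1 (by omega)
    rcases hc with ⟨rfl, rfl⟩ | ⟨rfl, rfl⟩
    · have := fin_big2
      simp only [allb_iff, Bool.or_eq_true, Nat.ble_eq, Bool.not_eq_true', Nat.succ_eq_add_one,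
        Nat.mul_eq, Nat.sub_eq, Bool.and_eq_true, Nat.beq_eq] at this
      rcases (this m h15).resolve_left (by omega) (a0 + a1) (by omega) with h | h | h
      · omega
      · rw [hch3] at h; cases h
      · rcases h a0 (by change a0 < (a0 + a1) / 2 + 1; omega) with h | h
        · omega
        · rw [hsub, hch2] at h; cases h
    · have := fin_big3
      simp only [allb_iff, Bool.or_eq_true, Nat.ble_eq, Bool.not_eq_true', Nat.succ_eq_add_one,
        Nat.mul_eq, Nat.sub_eq, Bool.and_eq_true, Nat.beq_eq] at this
      rcases (this m h15).resolve_left (by omega) (a0 + a1) (by omega) with h | h | h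
      · omega
      · rw [hch3] at h; cases h
      · rcases h a0 (by change a0 < (a0 + a1) / 2 + 1; omega) with h | h
        · omega
        · rw [hsub, hch2] at h; cases h
end CL


namespace CL
open scoped Pointwise
variable {G : Type*} [Group G] [Fintype G] [DecidableEq G]

/-- the hypotheses on the generating set -/
structure Dat (S : Finset G) (ε : G →* ℤˣ) (c K : ℕ) : Prop where
  hinv : ∀ s ∈ S, s * s = 1
  heps : ∀ s ∈ S, ε s = -1
  hgen : Subgroup.closure (S : Set G) = ⊤
  hr : ∀ g, g ≠ 1 → rep S g ≤ c
  h6 : ∀ s ∈ S, ∀ t ∈ S, (s * t) ^ 6 = 1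
  hm : 7 ≤ S.card
  hcK : (c = 2 ∧ K = 2 * S.card - 2) ∨ (c = 3 ∧ K = 2 * S.card - 3)

/-- parity part -/
def ev (ε : G →* ℤˣ) (e : ℤˣ) (A : Finset G) : Finset G := A.filter (fun x => ε x = e)

lemma mem_ev {ε : G →* ℤˣ} {e : ℤˣ} {A : Finset G} {x : G} : x ∈ ev ε e A ↔ x ∈ A ∧ ε x = e := by
  simp [ev]

lemma mem_nb {S A : Finset G} {v : G} : v ∈ nb S A ↔ ∃ s ∈ S, v * s ∈ A := by simp [nb]

lemma ev_card (ε : G →* ℤˣ) (e : ℤˣ) (A : Finset G) :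
    (ev ε e A).card + (ev ε (-e) A).card = A.card := by
  have : ev ε (-e) A = A.filter (fun x => ¬ ε x = e) := by
    ext x
    simp only [ev, Finset.mem_filter]
    refine and_congr_right fun _ => ?_
    rcases Int.units_eq_one_or (ε x) with h | h <;> rcases Int.units_eq_one_or e with h' | h' <;>
      rw [h, h'] <;> decide
  rw [this, ev, Finset.card_filter_add_card_filter_not]

lemma eps_nb {S : Finset G} {ε : G →* ℤˣ} {c K : ℕ} (hD : Dat S ε c K) {e : ℤˣ} {A : Finset G}
    {v : G} (hv : v ∈ nb S (ev ε e A)) : ε v = -e := by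
  obtain ⟨s, hs, h⟩ := mem_nb.1 hv
  have := (mem_ev.1 h).2
  rw [map_mul, hD.heps s hs] at this
  rw [← this]; simp

lemma nb_sum {S : Finset G} {ε : G →* ℤˣ} {c K : ℕ} (hD : Dat S ε c K) (e : ℤˣ) (A : Finset G) :
    (nb S (ev ε e A)).card + (nb S (ev ε (-e) A)).card ≤ (cl S A).card := by
  rw [← Finset.card_union_of_disjoint]
  · apply Finset.card_le_card
    intro v hv
    rw [mem_cl]
    right
    rcases Finset.mem_union.1 hv with h | h <;> obtain ⟨s, hs, h⟩ := mem_nb.1 h <;>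
      exact ⟨s, hs, (mem_ev.1 h).1⟩
  · rw [Finset.disjoint_left]
    intro v h1 h2
    have h1 := eps_nb hD h1
    have h2 := eps_nb hD h2
    rw [h1] at h2
    rcases Int.units_eq_one_or e with h' | h' <;> rw [h'] at h2 <;> revert h2 <;> decide

lemma ev_sub_nb {S : Finset G} {ε : G →* ℤˣ} {c K : ℕ} (hD : Dat S ε c K) (e : ℤˣ) (A : Finset G)
    (h : ∀ x ∈ A, ∃ s ∈ S, x * s ∈ A) : ev ε (-e) A ⊆ nb S (ev ε e A) := by
  intro x hx
  obtain ⟨hx, hxe⟩ := mem_ev.1 hx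
  obtain ⟨s, hs, h⟩ := h x hx
  refine mem_nb.2 ⟨s, hs, mem_ev.2 ⟨h, ?_⟩⟩
  rw [map_mul, hD.heps s hs, hxe]; simp

lemma card_le_nb {S A : Finset G} {x : G} (hx : x ∈ A) : S.card ≤ (nb S A).card := by
  apply Finset.card_le_card_of_injOn (fun s => x * s⁻¹)
  · intro s hs
    exact mem_nb.2 ⟨s, hs, by simpa using hx⟩
  · intro s _ t _ h
    simpa using h

lemma moment1 {S : Finset G} {ε : G →* ℤˣ} {c K : ℕ} (hD : Dat S ε c K) (A : Finset G) :
    S.card ^ 2 * A.card ≤ (nb S A).card * (S.card + c * (A.card - 1)) := by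
  have := second_moment (A := A) hD.hinv hD.hr hD.h6 ⊥ (by simp) (by
    intro g hg x hx
    rw [Subgroup.mem_bot.1 hg, one_mul]; exact hx)
  simpa using this

lemma univ_of_closed {S : Finset G} {ε : G →* ℤˣ} {c K : ℕ} (hD : Dat S ε c K) (A : Finset G)
    (hA : A.Nonempty) (h : (cl S A).card = A.card) : A = Finset.univ := by
  have hcl : cl S A = A := (Finset.eq_of_subset_of_card_le (subset_cl S A) h.le).symm
  obtain ⟨x, hx⟩ := hA
  have hmul : ∀ g : G, ∀ y ∈ A, y * g ∈ A := by
    intro g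
    have hg : g ∈ Subgroup.closure (S : Set G) := by rw [hD.hgen]; trivial
    induction hg using Subgroup.closure_induction'' with
    | one => intro y hy; simpa using hy
    | mem s hs =>
      intro y hy
      rw [← hcl, mem_cl]
      exact Or.inr ⟨s, hs, by rwa [mul_assoc, hD.hinv s hs, mul_one]⟩
    | inv_mem s hs =>
      intro y hy
      rw [← hcl, mem_cl]
      exact Or.inr ⟨s, hs, by simpa using hy⟩
    | mul a b _ _ ha hb =>
      intro y hy
      rw [← mul_assoc]; exact hb _ (ha _ hy)
  apply Finset.eq_univ_of_forall
  intro g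
  have := hmul (x⁻¹ * g) x hx
  simpa using this

/-- atoms of size three are impossible -/
lemma three_case {S : Finset G} {ε : G →* ℤˣ} {c K : ℕ} (hD : Dat S ε c K) (A : Finset G)
    (hA : A.card = 3) (hK : (cl S A).card ≤ A.card + K) : False := by
  have hm := hD.hm
  obtain ⟨e, he⟩ : ∃ e : ℤˣ, (ev ε e A).card ≤ (ev ε (-e) A).card := by
    rcases le_total (ev ε 1 A).card (ev ε (-1) A).card with h | h
    · exact ⟨1, h⟩
    · exact ⟨-1, by simpa using h⟩
  have hs := ev_card ε e A
  have hN := nb_sum hD e A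
  have f1 := moment1 hD (ev ε (-e) A)
  rcases Nat.eq_zero_or_pos (ev ε e A).card with h0 | h0
  · have hE : ev ε (-e) A = A := Finset.eq_of_subset_of_card_le (Finset.filter_subset _ _) (by omega)
    have hdis : Disjoint A (nb S A) := by
      rw [Finset.disjoint_left]
      intro v hv hv2
      rw [← hE] at hv hv2
      have h1 := (mem_ev.1 hv).2
      have h2 := eps_nb hD hv2
      rw [h1] at h2
      rcases Int.units_eq_one_or e with h' | h' <;> rw [h'] at h2 <;> revert h2 <;> decide
    have : (cl S A).card = A.card + (nb S A).card := Finset.card_union_of_disjoint hdis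
    rw [hE, hA] at f1
    have hn : (nb S A).card ≤ K := by omega
    rcases hD.hcK with ⟨rfl, hK2⟩ | ⟨rfl, hK2⟩
    · have : (nb S A).card + 2 ≤ 2 * S.card := by omega
      zify at *
      nlinarith
    · have : (nb S A).card + 3 ≤ 2 * S.card := by omega
      zify at *
      nlinarith
  · have h1 : (ev ε e A).card = 1 := by omega
    have h2 : (ev ε (-e) A).card = 2 := by omega
    obtain ⟨x, hx⟩ := Finset.card_pos.1 h0
    have hb := card_le_nb (S := S) hx
    rw [h2] at f1
    rcases hD.hcK with ⟨rfl, hK2⟩ | ⟨rfl, hK2⟩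
    · have : (nb S (ev ε (-e) A)).card ≤ S.card + 1 := by omega
      zify at *
      nlinarith
    · have : (nb S (ev ε (-e) A)).card ≤ S.card := by omega
      zify at *
      nlinarith

lemma le_five {S : Finset G} {A : Finset G} (hm : 7 ≤ S.card)
    (h : ∀ g : G, 3 ≤ (A ∩ g • A).card → g • A = A) (k : ℕ)
    (hk : Nat.card (MulAction.stabilizer G A) = k) (hkm : k + 2 ≤ 2 * S.card)
    (hκ : (cl S A).card + 2 ≤ A.card + 2 * S.card) : A.card ≤ 5 * S.card := by
  by_contra hlt
  push Not at hlt
  obtain ⟨m, hmS⟩ : ∃ m : ℝ, m = S.card := ⟨_, rfl⟩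
  obtain ⟨y, hy⟩ : ∃ y : ℝ, y = 5 * m / 7 := ⟨_, rfl⟩
  have hm' : (7 : ℝ) ≤ m := by rw [hmS]; exact_mod_cast hm
  have hy5 : 5 ≤ y := by rw [hy]; linarith
  have := third_real (S := S) h (3 * y ^ 2 - 6 * y + 2) (y ^ 2 * (2 * y - 3)) (by
    intro d
    have hd : (0 : ℝ) ≤ d := by positivity
    nlinarith [mul_nonneg (sq_nonneg ((d : ℝ) - y)) (by linarith : (0 : ℝ) ≤ d + 2 * y - 3)])
  rw [hk, ← hmS] at this
  have hlt' : 5 * m < (A.card : ℝ) := by rw [hmS]; exact_mod_cast hlt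
  have hκ' : ((cl S A).card : ℝ) + 2 ≤ A.card + 2 * m := by rw [hmS]; exact_mod_cast hκ
  have hk' : (k : ℝ) + 2 ≤ 2 * m := by rw [hmS]; exact_mod_cast hkm
  generalize (A.card : ℝ) = a at *
  generalize ((cl S A).card : ℝ) = N at *
  generalize (k : ℝ) = k at *
  have hb : 0 ≤ y ^ 2 * (2 * y - 3) := mul_nonneg (sq_nonneg _) (by linarith)
  have h1 : N ≤ 7 / 5 * a := by linarith
  have h2 := mul_le_mul_of_nonneg_left h1 hb
  have h3 : 0 ≤ m * (m - 1) * (m - 2) :=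
    mul_nonneg (mul_nonneg (by linarith) (by linarith)) (by linarith)
  have h4 := mul_le_mul_of_nonneg_right (by linarith : k ≤ 2 * m - 2) h3
  have hmy : m = 7 / 5 * y := by rw [hy]; ring
  have h5 : a * m * ((y - 1) * (y - 2)) ≤ (2 * m - 2) * (m * (m - 1) * (m - 2)) := by
    have e : a * m * ((y - 1) * (y - 2)) = (3 * y ^ 2 - 6 * y + 2) * (m * a) -
      y ^ 2 * (2 * y - 3) * (7 / 5 * a) := by rw [hmy]; ring
    rw [e]; linarith
  have h6 : 5 * m * m * ((y - 1) * (y - 2)) ≤ a * m * ((y - 1) * (y - 2)) := by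
    apply mul_le_mul_of_nonneg_right
    · nlinarith
    · exact mul_nonneg (by linarith) (by linarith)
  have h7 : 5 * m * m * ((y - 1) * (y - 2)) =
      m * (5 * m * (5 * m - 7) * (5 * m - 14) / 49) := by rw [hy]; ring
  have h8 : m * (5 * m * (5 * m - 7) * (5 * m - 14) / 49) ≤
      m * ((2 * m - 2) * (m - 1) * (m - 2)) := by rw [← h7]; linarith
  have h9 := le_of_mul_le_mul_left h8 (by linarith)
  nlinarith [mul_nonneg (sub_nonneg.2 hm') (sub_nonneg.2 hm'),
    mul_nonneg (mul_nonneg (sub_nonneg.2 hm') (sub_nonneg.2 hm')) (sub_nonneg.2 hm')]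

lemma third_nat {S : Finset G} {A : Finset G} (hm : 7 ≤ S.card)
    (h : ∀ g : G, 3 ≤ (A ∩ g • A).card → g • A = A) (j : ℕ) :
    3 * (j * (j - 1)) * (S.card * A.card) ≤ 2 * (j * (j - 1)) * (j + 1) * (cl S A).card +
      Nat.card (MulAction.stabilizer G A) * (S.card * (S.card - 1) * (S.card - 2)) := by
  rcases Nat.eq_zero_or_pos j with rfl | hj
  · simp
  have := third_real (S := S) h (3 * (j * (j - 1))) (2 * (j * (j - 1)) * (j + 1)) (by
    intro d
    have h0 : (0 : ℝ) ≤ d + 2 * j - 2 := by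
      have : (0 : ℝ) ≤ d := by positivity
      have : (1 : ℝ) ≤ j := by exact_mod_cast hj
      linarith
    have h1 : (0 : ℝ) ≤ ((d : ℝ) - j) * (d - j - 1) := by
      rcases Nat.lt_or_ge j d with h | h
      · have : (j : ℝ) + 1 ≤ d := by exact_mod_cast h
        exact mul_nonneg (by linarith) (by linarith)
      · have : (d : ℝ) ≤ j := by exact_mod_cast h
        exact mul_nonneg_of_nonpos_of_nonpos (by linarith) (by linarith)
    nlinarith [mul_nonneg h1 h0])
  rify
  rw [Nat.cast_sub hj, Nat.cast_sub (by omega : 1 ≤ S.card), Nat.cast_sub (by omega : 2 ≤ S.card)]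
  push_cast
  linarith

/-- killing the exceptional parameter sets -/
lemma prime_case {S : Finset G} {ε : G →* ℤˣ} {K : ℕ} (hD : Dat S ε 3 K) (A : Finset G)
    (p : ℕ) (hp : p.Prime) (hp5 : 5 ≤ p)
    (hdvd : p ∣ Nat.card (MulAction.stabilizer G A)) (e : ℤˣ) (he : (ev ε e A).Nonempty) :
    p ≤ (ev ε e A).card ∧ S.card ^ 2 * (ev ε e A).card ≤
      (nb S (ev ε e A)).card * (S.card + 3 * ((ev ε e A).card - p)) := by
  have := Fact.mk hp
  obtain ⟨g, hg⟩ := exists_prime_orderOf_dvd_card' p hdvd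
  have hgo : orderOf (g : G) = p := by rw [← hg]; exact Subgroup.orderOf_coe g
  have hcard : Nat.card (Subgroup.zpowers (g : G)) = p := by rw [Nat.card_zpowers, hgo]
  have hodd : Odd p := hp.odd_of_ne_two (by omega)
  have heps : ε (g : G) = 1 := by
    have h1 : ε (g : G) ^ p = 1 := by rw [← map_pow, ← hgo, pow_orderOf_eq_one, map_one]
    rcases Int.units_eq_one_or (ε (g : G)) with h | h
    · exact h
    · rw [h, hodd.neg_one_pow] at h1; exact absurd h1 (by decide)
  have hpres : ∀ h ∈ Subgroup.zpowers (g : G), ∀ x ∈ ev ε e A, h * x ∈ ev ε e A := by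
    intro h hh x hx
    obtain ⟨z, rfl⟩ := Subgroup.mem_zpowers_iff.1 hh
    obtain ⟨hx, hxe⟩ := mem_ev.1 hx
    refine mem_ev.2 ⟨?_, ?_⟩
    · have : (g : G) ^ z ∈ MulAction.stabilizer G A := Subgroup.zpow_mem _ g.2 z
      rw [MulAction.mem_stabilizer_iff] at this
      have h9 := Finset.smul_mem_smul_finset (a := (g : G) ^ z) hx
      rw [this] at h9
      exact h9
    · rw [map_mul, map_zpow, heps, one_zpow, one_mul, hxe]
  have hcop : (Nat.card (Subgroup.zpowers (g : G))).Coprime 6 := by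
    rw [hcard, hp.coprime_iff_not_dvd]
    intro h
    have := Nat.le_of_dvd (by norm_num) h
    interval_cases p
    · omega
    · exact absurd hp (by norm_num)
  have hsm := second_moment hD.hinv hD.hr hD.h6 _ hcop hpres
  rw [hcard] at hsm
  refine ⟨?_, hsm⟩
  have hd : p ∣ (ev ε e A).card := by
    rw [← hcard]
    apply card_dvd_of_smul
    intro h hh
    apply Finset.eq_of_subset_of_card_le
    · intro v hv
      obtain ⟨x, hx, rfl⟩ := Finset.mem_smul_finset.1 hv
      exact hpres h hh x hx
    · rw [Finset.card_smul_finset]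
  exact Nat.le_of_dvd he.card_pos hd

theorem key {S : Finset G} {ε : G →* ℤˣ} {c K : ℕ} (hD : Dat S ε c K) (A₀ : Finset G)
    (h3 : 3 ≤ A₀.card) (hcl : (cl S A₀).card + 3 ≤ Fintype.card G) :
    A₀.card + K < (cl S A₀).card := by
  by_contra hcon
  push Not at hcon
  obtain ⟨A, hF, hle, hmin⟩ := exists_atom S A₀ ⟨h3, hcl⟩
  have hat : Atom S A := ⟨hF, hmin⟩
  have hm := hD.hm
  have hK : (cl S A).card ≤ A.card + K := by omega
  rcases Nat.lt_or_ge A.card 4 with h4 | h4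
  · exact three_case hD A (by have := hF.1; omega) hK
  have hnbr := hat.nbr h4
  have hinter := hat.inter hD.hinv
  obtain ⟨κ, hκ⟩ : ∃ κ, (cl S A).card = A.card + κ :=
    ⟨(cl S A).card - A.card, by have := Finset.card_le_card (subset_cl S A); omega⟩
  have hκ1 : 1 ≤ κ := by
    by_contra h0
    have := univ_of_closed hD A (Finset.card_pos.1 (by omega)) (by omega)
    have h2 := hF.2
    rw [hκ, this, Finset.card_univ] at h2
    omega
  obtain ⟨k, hk⟩ : ∃ k, Nat.card (MulAction.stabilizer G A) = k := ⟨_, rfl⟩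
  have hka : k ∣ A.card := by
    rw [← hk]; exact card_dvd_of_smul fun g hg => MulAction.mem_stabilizer_iff.1 hg
  have hkκ : k ∣ κ := by
    have : k ∣ (cl S A).card := by
      rw [← hk]; exact card_dvd_of_smul fun g hg => by
        rw [← cl_smul, MulAction.mem_stabilizer_iff.1 hg]
    rw [hκ] at this
    exact (Nat.dvd_add_right hka).1 this
  have hkle : k ≤ κ := Nat.le_of_dvd hκ1 hkκ
  have h5 : A.card ≤ 5 * S.card := le_five hm hinter k hk
    (by rcases hD.hcK with h | h <;> omega) (by rcases hD.hcK with h | h <;> omega)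
  have ht := third_nat hm hinter
  rw [hk, hκ] at ht
  obtain ⟨e, he⟩ : ∃ e : ℤˣ, (ev ε e A).card ≤ (ev ε (-e) A).card := by
    rcases le_total (ev ε 1 A).card (ev ε (-1) A).card with h | h
    · exact ⟨1, h⟩
    · exact ⟨-1, by simpa using h⟩
  have hs := ev_card ε e A
  have hN := nb_sum hD e A
  have hsub := ev_sub_nb hD e A hnbr
  have hsub' := ev_sub_nb hD (-e) A hnbr
  rw [neg_neg] at hsub'
  have h1ne : (ev ε (-e) A).Nonempty := Finset.card_pos.1 (by omega)
  have h0ne : (ev ε e A).Nonempty := by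
    obtain ⟨x, hx⟩ := h1ne
    obtain ⟨s, hs, h⟩ := mem_nb.1 (hsub hx)
    exact ⟨_, h⟩
  have hm0 : S.card ≤ (nb S (ev ε e A)).card := card_le_nb h0ne.choose_spec
  simp only [← hs] at ht
  obtain ⟨rfl, rfl, hak, hex⟩ := num S.card c κ K k _ _ _ _ hm hD.hcK hκ1 (by omega) hkκ
    (by rw [hs]; exact hka) h0ne.card_pos he (by omega) (by omega) hm0 (moment1 hD (ev ε e A))
    (moment1 hD (ev ε (-e) A)) (Finset.card_le_card hsub) (Finset.card_le_card hsub')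
    (by omega) ht
  have main : ∀ p, p.Prime → 5 ≤ p → p ∣ κ → ∀ e', (ev ε e' A).Nonempty → 
      p ≤ (ev ε e' A).card ∧ S.card ^ 2 * (ev ε e' A).card ≤
      (nb S (ev ε e' A)).card * (S.card + 3 * ((ev ε e' A).card - p)) := fun p hp hp5 hd e' he' =>
    prime_case hD A p hp hp5 (by rw [hk]; exact hd) e' he'
  rcases hex with ⟨hm', rfl⟩ | ⟨hm', rfl⟩ | ⟨hm', rfl⟩
  · obtain ⟨p0, q0⟩ := main 5 (by norm_num) (by norm_num) (by norm_num) e h0ne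
    obtain ⟨p1, q1⟩ := main 5 (by norm_num) (by norm_num) (by norm_num) (-e) h1ne
    rw [hm'] at q0 q1
    have hu : (ev ε e A).card ≤ 10 := by omega
    have hv : (ev ε (-e) A).card = 20 - (ev ε e A).card := by omega
    rw [hv] at q1
    generalize (ev ε e A).card = a at *
    interval_cases a <;> omega
  · obtain ⟨p0, q0⟩ := main 11 (by norm_num) (by norm_num) (by norm_num) e h0ne
    obtain ⟨p1, q1⟩ := main 11 (by norm_num) (by norm_num) (by norm_num) (-e) h1ne
    have e0 : (ev ε e A).card = 11 := by omega
    rw [hm', e0] at q0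
    omega
  · obtain ⟨p0, q0⟩ := main 13 (by norm_num) (by norm_num) (by norm_num) e h0ne
    obtain ⟨p1, q1⟩ := main 13 (by norm_num) (by norm_num) (by norm_num) (-e) h1ne
    have e0 : (ev ε e A).card = 13 := by omega
    rw [hm', e0] at q0
    omega

end CL


namespace CL
open scoped Pointwise

lemma comp_big {V : Type*} [Fintype V] [DecidableEq V] (H : SimpleGraph V)
    (hV : 7 ≤ Fintype.card V)
    (hcl : ∀ X : Finset V, (∀ x ∈ X, ∀ y, H.Adj x y → y ∈ X) → X.card ≤ 2 ∨ Xᶜ.card ≤ 2) :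
    ∃ c : H.ConnectedComponent, (c.suppᶜ).ncard ≤ 2 := by
  classical
  by_contra hcon
  push Not at hcon
  have hsm : ∀ c : H.ConnectedComponent, c.supp.toFinset.card ≤ 2 := by
    intro c
    refine (hcl c.supp.toFinset ?_).resolve_right ?_
    · intro x hx y hxy
      rw [Set.mem_toFinset] at *
      exact (SimpleGraph.ConnectedComponent.mem_supp_congr_adj c hxy).1 hx
    · have := hcon c
      rw [Set.ncard_eq_toFinset_card', Set.toFinset_compl] at this
      omega
  have hmain : ∀ k, ∀ X : Finset V, X.card = k → 3 ≤ k →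
      (∀ x ∈ X, ∀ y, H.Adj x y → y ∈ X) → False := by
    intro k
    induction k using Nat.strong_induction_on with
    | _ k ih =>
      intro X hX hk hclX
      have h5 : 5 ≤ X.card := by
        rcases hcl X hclX with h | h
        · omega
        · rw [Finset.card_compl] at h; omega
      obtain ⟨x, hx⟩ := Finset.card_pos.1 (by omega : 0 < X.card)
      obtain ⟨c, hc⟩ : ∃ c, c = H.connectedComponentMk x := ⟨_, rfl⟩
      have hxc : x ∈ c.supp := by rw [hc]; exact SimpleGraph.ConnectedComponent.connectedComponentMk_mem
      have h1 : (X \ c.supp.toFinset).card < X.card := by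
        apply Finset.card_lt_card
        refine ⟨Finset.sdiff_subset, fun h => ?_⟩
        have := h hx
        simp [hxc] at this
      have h2 := Finset.le_card_sdiff c.supp.toFinset X
      have h3 := hsm c
      refine ih (X \ c.supp.toFinset).card (by omega) _ rfl (by omega) ?_
      intro u hu v huv
      rw [Finset.mem_sdiff, Set.mem_toFinset] at *
      exact ⟨hclX u hu.1 v huv, fun h => hu.2 
        ((SimpleGraph.ConnectedComponent.mem_supp_congr_adj c huv).2 h)⟩
  exact hmain _ Finset.univ rfl (by rw [Finset.card_univ]; omega) (by simp)

lemma classify {V : Type*} [Finite V] (H : SimpleGraph V) (c : H.ConnectedComponent)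
    (hc : (c.suppᶜ).ncard ≤ 2) :
    H.Connected ∨ (¬ H.Connected ∧ Nat.card H.ConnectedComponent = 2 ∧
      ∃ d : H.ConnectedComponent, d.supp.ncard = 1) ∨
    (∃ x y, H.Adj x y ∧ (∀ z, H.Adj x z → z = y) ∧ (∀ z, H.Adj y z → z = x) ∧
      ¬ H.Connected ∧ Nat.card H.ConnectedComponent = 2 ∧
      ∃ d : H.ConnectedComponent, d.supp.ncard = 2) ∨
    (∃ x y, x ≠ y ∧ (∀ z, ¬ H.Adj x z) ∧ (∀ z, ¬ H.Adj y z) ∧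
      ¬ H.Connected ∧ Nat.card H.ConnectedComponent = 3 ∧
      ∃ d₁ d₂ : H.ConnectedComponent, d₁ ≠ d₂ ∧ d₁.supp.ncard = 1 ∧ d₂.supp.ncard = 1) := by
  classical
  have hnc : 2 ≤ Nat.card H.ConnectedComponent → ¬ H.Connected := by
    intro h hconn
    have := hconn.preconnected.subsingleton_connectedComponent
    have := Finite.card_le_one_iff_subsingleton (α := H.ConnectedComponent) |>.2 this
    omega
  have hcv : ∀ v, v ∈ c.supp ↔ H.connectedComponentMk v = c := fun v => Iff.rfl
  have hadj : ∀ {x z}, x ∉ c.supp → H.Adj x z → z ∉ c.supp := by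
    intro x z hx hxz hz
    exact hx ((SimpleGraph.ConnectedComponent.mem_supp_congr_adj c hxz).2 hz)
  rcases Nat.lt_or_ge (c.suppᶜ).ncard 1 with h0 | h0
  · left
    have he : c.suppᶜ = ∅ := by
      rw [← Set.ncard_eq_zero]; omega
    have hall : ∀ v, H.connectedComponentMk v = c := by
      intro v
      rw [← hcv]; by_contra h
      have : v ∈ c.suppᶜ := h
      rw [he] at this; exact this
    obtain ⟨v, hv⟩ := c.nonempty_supp
    have : Nonempty V := ⟨v⟩
    refine ⟨fun x y => ?_⟩
    rw [← SimpleGraph.ConnectedComponent.eq, hall x, hall y]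
  right
  rcases Nat.lt_or_ge (c.suppᶜ).ncard 2 with h1 | h1
  · left
    obtain ⟨x, hx⟩ := Set.ncard_eq_one.1 (by omega : (c.suppᶜ).ncard = 1)
    have hxn : ∀ v, v ∉ c.supp ↔ v = x := fun v => by
      have : v ∈ c.suppᶜ ↔ v ∈ ({x} : Set V) := by rw [hx]
      simpa using this
    have hne : c ≠ H.connectedComponentMk x := fun h => (hxn x).2 rfl ((hcv x).2 h.symm)
    have hcard : Nat.card H.ConnectedComponent = 2 := by
      rw [Nat.card_eq_two_iff]
      refine ⟨c, H.connectedComponentMk x, hne, ?_⟩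
      rw [Set.eq_univ_iff_forall]
      intro d
      induction d using SimpleGraph.ConnectedComponent.ind with
      | _ v =>
        by_cases hv : v ∈ c.supp
        · left; exact hv
        · right; rw [(hxn v).1 hv]; rfl
    refine ⟨hnc hcard.ge, hcard, H.connectedComponentMk x, ?_⟩
    rw [Set.ncard_eq_one]
    refine ⟨x, ?_⟩
    ext v
    rw [Set.mem_singleton_iff, ← hxn, SimpleGraph.ConnectedComponent.mem_supp_iff, hcv]
    constructor
    · intro h h'; exact hne (h' ▸ h)
    · intro h; rw [← hcv, hxn] at h; rw [h]
  right
  obtain ⟨x, y, hxy, hx⟩ := Set.ncard_eq_two.1 (by omega : (c.suppᶜ).ncard = 2)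
  have hxn : ∀ v, v ∉ c.supp ↔ v = x ∨ v = y := fun v => by
    have : v ∈ c.suppᶜ ↔ v ∈ ({x, y} : Set V) := by rw [hx]
    simpa using this
  have hnx : c ≠ H.connectedComponentMk x := fun h => (hxn x).2 (Or.inl rfl) ((hcv x).2 h.symm)
  have hny : c ≠ H.connectedComponentMk y := fun h => (hxn y).2 (Or.inr rfl) ((hcv y).2 h.symm)
  by_cases had : H.Adj x y
  · left
    have hmk : H.connectedComponentMk y = H.connectedComponentMk x :=
      (SimpleGraph.ConnectedComponent.connectedComponentMk_eq_of_adj had).symm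
    have hcard : Nat.card H.ConnectedComponent = 2 := by
      rw [Nat.card_eq_two_iff]
      refine ⟨c, H.connectedComponentMk x, hnx, ?_⟩
      rw [Set.eq_univ_iff_forall]
      intro d
      induction d using SimpleGraph.ConnectedComponent.ind with
      | _ v =>
        by_cases hv : v ∈ c.supp
        · left; exact hv
        · right
          rcases (hxn v).1 hv with rfl | rfl
          · rfl
          · exact hmk
    refine ⟨x, y, had, ?_, ?_, hnc hcard.ge, hcard, H.connectedComponentMk x, ?_⟩
    · intro z hz
      rcases (hxn z).1 (hadj ((hxn x).2 (Or.inl rfl)) hz) with rfl | h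
      · exact absurd hz (H.irrefl)
      · exact h
    · intro z hz
      rcases (hxn z).1 (hadj ((hxn y).2 (Or.inr rfl)) hz) with h | rfl
      · exact h
      · exact absurd hz (H.irrefl)
    · rw [Set.ncard_eq_two]
      refine ⟨x, y, hxy, ?_⟩
      ext v
      rw [Set.mem_insert_iff, Set.mem_singleton_iff, ← hxn,
        SimpleGraph.ConnectedComponent.mem_supp_iff, hcv]
      constructor
      · intro h h'; exact hnx (h' ▸ h)
      · intro h; rw [← hcv, hxn] at h
        rcases h with rfl | rfl
        · rfl
        · exact hmk
  · right
    have hx0 : ∀ z, ¬ H.Adj x z := by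
      intro z hz
      rcases (hxn z).1 (hadj ((hxn x).2 (Or.inl rfl)) hz) with rfl | rfl
      · exact H.irrefl hz
      · exact had hz
    have hy0 : ∀ z, ¬ H.Adj y z := by
      intro z hz
      rcases (hxn z).1 (hadj ((hxn y).2 (Or.inr rfl)) hz) with rfl | rfl
      · exact had hz.symm
      · exact H.irrefl hz
    have hiso : ∀ u v, (∀ z, ¬ H.Adj u z) → H.connectedComponentMk v = H.connectedComponentMk u →
        v = u := by
      intro u v hu h
      obtain ⟨w⟩ := SimpleGraph.ConnectedComponent.eq.1 h.symm
      cases w with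
      | nil => rfl
      | cons h _ => exact absurd h (hu _)
    have hsupp : ∀ u, (∀ z, ¬ H.Adj u z) → (H.connectedComponentMk u).supp.ncard = 1 := by
      intro u hu
      rw [Set.ncard_eq_one]
      refine ⟨u, ?_⟩
      ext v
      rw [Set.mem_singleton_iff, SimpleGraph.ConnectedComponent.mem_supp_iff]
      exact ⟨hiso u v hu, fun h => by rw [h]⟩
    have hne : H.connectedComponentMk x ≠ H.connectedComponentMk y := fun h => hxy (hiso y x hy0 h)
    have hcard : Nat.card H.ConnectedComponent = 3 := by
      rw [← Set.ncard_univ, Set.ncard_eq_three]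
      refine ⟨c, H.connectedComponentMk x, H.connectedComponentMk y, hnx, hny, hne, ?_⟩
      symm
      rw [Set.eq_univ_iff_forall]
      intro d
      induction d using SimpleGraph.ConnectedComponent.ind with
      | _ v =>
        by_cases hv : v ∈ c.supp
        · left; exact hv
        · right
          rcases (hxn v).1 hv with rfl | rfl
          · left; rfl
          · right; rfl
    exact ⟨x, y, hxy, hx0, hy0, hnc (by omega), hcard, _, _, hne, hsupp x hx0, hsupp y hy0⟩

variable {G : Type*} [Group G] [Fintype G] [DecidableEq G]

lemma pair_adj {S : Finset G} {ε : G →* ℤˣ} {c K : ℕ} (hD : Dat S ε c K) (x s : G) (hs : s ∈ S)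
    (T : Finset G) (hT : cl S {x, x * s} ⊆ {x, x * s} ∪ T) : 2 * S.card ≤ T.card + 2 := by
  have h := nb_sum hD (ε x) {x, x * s}
  have h1 : x ∈ ev ε (ε x) {x, x * s} := mem_ev.2 ⟨by simp, rfl⟩
  have h2 : x * s ∈ ev ε (-ε x) {x, x * s} := mem_ev.2 ⟨by simp, by
    rw [map_mul, hD.heps s hs]; simp⟩
  have h1 := card_le_nb (S := S) h1
  have h2 := card_le_nb (S := S) h2
  have h3 := (Finset.card_le_card hT).trans (Finset.card_union_le _ _)
  have h4 : ({x, x * s} : Finset G).card ≤ 2 := Finset.card_le_two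
  omega

lemma pair_nonadj {S : Finset G} {ε : G →* ℤˣ} {c K : ℕ} (hD : Dat S ε c K) (x y : G) (hxy : x ≠ y)
    (T : Finset G) (hx : nb S {x} ⊆ T) (hy : nb S {y} ⊆ T) : 2 * S.card ≤ T.card + c := by
  have h1 := card_le_nb (S := S) (Finset.mem_singleton_self x)
  have h2 := card_le_nb (S := S) (Finset.mem_singleton_self y)
  have h3 := Finset.card_union_add_card_inter (nb S {x}) (nb S {y})
  have h4 := Finset.card_le_card (Finset.union_subset hx hy)
  have h5 : (nb S {x} ∩ nb S {y}).card ≤ rep S (x⁻¹ * y) := by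
    apply Finset.card_le_card_of_injOn (fun v => x⁻¹ * v)
    · intro v hv
      rw [Finset.mem_coe, Finset.mem_inter, mem_nb, mem_nb] at hv
      obtain ⟨⟨s, hs, h⟩, ⟨t, ht, h'⟩⟩ := hv
      rw [Finset.mem_singleton] at h h'
      have hsi : s⁻¹ = s := inv_eq_of_mul_eq_one_left (hD.hinv s hs)
      rw [Finset.mem_coe, Finset.mem_filter]
      constructor
      · change x⁻¹ * v ∈ S
        rw [← h, mul_inv_rev, mul_assoc, inv_mul_cancel, mul_one, hsi]; exact hs
      · rw [← h']; simpa using ht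
    · intro u _ v _ h
      simpa using h
  have h6 := hD.hr (x⁻¹ * y) (by rw [Ne, inv_mul_eq_one]; exact hxy)
  omega

theorem abs_main {S : Finset G} {ε : G →* ℤˣ} {c K : ℕ} (hD : Dat S ε c K) (H : SimpleGraph G)
    (hH : ∀ x y, H.Adj x y ↔ ∃ s ∈ S, y = x * s) (T : Set G) (hT : T.ncard ≤ K)
    (hG : T.ncard + 7 ≤ Fintype.card G) :
    (H.induce Tᶜ).Connected ∨ (¬ (H.induce Tᶜ).Connected ∧ 
      Nat.card (H.induce Tᶜ).ConnectedComponent = 2 ∧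
      ∃ d : (H.induce Tᶜ).ConnectedComponent, d.supp.ncard = 1) ∨
    (2 * S.card ≤ T.ncard + 2 ∧
      ¬ (H.induce Tᶜ).Connected ∧ Nat.card (H.induce Tᶜ).ConnectedComponent = 2 ∧
      ∃ d : (H.induce Tᶜ).ConnectedComponent, d.supp.ncard = 2) ∨
    (2 * S.card ≤ T.ncard + c ∧
      ¬ (H.induce Tᶜ).Connected ∧ Nat.card (H.induce Tᶜ).ConnectedComponent = 3 ∧
      ∃ d₁ d₂ : (H.induce Tᶜ).ConnectedComponent, d₁ ≠ d₂ ∧ 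
        d₁.supp.ncard = 1 ∧ d₂.supp.ncard = 1) := by
  classical
  have hTc : T.toFinset.card = T.ncard := (Set.ncard_eq_toFinset_card' T).symm
  have hnb : ∀ v w s : G, s ∈ S → v * s = w → H.Adj w v := by
    rintro v w s hs rfl
    exact (hH _ _).2 ⟨s, hs, by rw [mul_assoc, hD.hinv s hs, mul_one]⟩
  have hV : Fintype.card (↥(Tᶜ : Set G)) + T.ncard = Fintype.card G := by
    rw [← Nat.card_eq_fintype_card, Nat.card_coe_set_eq, ← Nat.card_eq_fintype_card, add_comm]
    exact Set.ncard_add_ncard_compl T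
  obtain ⟨b, hb⟩ := comp_big (H.induce Tᶜ) (by omega) (by
    intro X hX
    by_contra hcon
    push Not at hcon
    obtain ⟨hc1, hc2⟩ := hcon
    have hcA : ∀ Y : Finset ↥(Tᶜ : Set G),
      (Y.map (Function.Embedding.subtype _)).card = Y.card := fun Y => Finset.card_map _
    obtain ⟨A, hA⟩ : ∃ A : Finset G, A = X.map (Function.Embedding.subtype _) := ⟨_, rfl⟩
    obtain ⟨B, hB⟩ : ∃ B : Finset G, B = Xᶜ.map (Function.Embedding.subtype _) := ⟨_, rfl⟩
    have hmA : ∀ v, v ∈ A ↔ ∃ h : v ∈ Tᶜ, (⟨v, h⟩ : ↥(Tᶜ : Set G)) ∈ X := by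
      intro v; rw [hA]; simp
    have hmB : ∀ v, v ∈ B ↔ ∃ h : v ∈ Tᶜ, (⟨v, h⟩ : ↥(Tᶜ : Set G)) ∉ X := by
      intro v; rw [hB]; simp
    have hsub : cl S A ⊆ A ∪ T.toFinset := by
      intro v hv
      rw [Finset.mem_union, Set.mem_toFinset]
      rcases mem_cl.1 hv with h | ⟨s, hs, h⟩
      · exact Or.inl h
      · by_cases hvT : v ∈ T
        · exact Or.inr hvT
        · left
          obtain ⟨h1, h2⟩ := (hmA _).1 h
          exact (hmA v).2 ⟨hvT, hX _ h2 ⟨v, hvT⟩ (hnb v (v * s) s hs rfl)⟩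
    have hdis : Disjoint (cl S A) B := by
      rw [Finset.disjoint_left]
      intro v hv hvB
      obtain ⟨h1, h2⟩ := (hmB v).1 hvB
      have := hsub hv
      rw [Finset.mem_union, Set.mem_toFinset] at this
      rcases this with h | h
      · obtain ⟨_, h3⟩ := (hmA v).1 h
        exact h2 h3
      · exact h1 h
    have e1 := Finset.card_union_of_disjoint hdis
    have e2 := Finset.card_le_univ (cl S A ∪ B)
    have e3 := (Finset.card_le_card hsub).trans (Finset.card_union_le _ _)
    have e4 : A.card = X.card := by rw [hA]; exact hcA X
    have e5 : B.card = Xᶜ.card := by rw [hB]; exact hcA Xᶜ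
    have := key hD A (by omega) (by omega)
    omega)
  rcases classify _ b hb with h | h | ⟨x, y, hxy, hx, hy, h⟩ | ⟨x, y, hxy, hx, hy, h⟩
  · exact Or.inl h
  · exact Or.inr (Or.inl h)
  · refine Or.inr (Or.inr (Or.inl ⟨?_, h⟩))
    obtain ⟨s, hs, hys⟩ := (hH _ _).1 (show H.Adj x y from hxy)
    rw [← hTc]
    apply pair_adj hD (x : G) s hs
    rw [← hys]
    intro v hv
    rw [Finset.mem_union, Set.mem_toFinset]
    rcases mem_cl.1 hv with h | ⟨s, hs, h⟩
    · exact Or.inl h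
    · by_cases hvT : v ∈ T
      · exact Or.inr hvT
      · left
        rw [Finset.mem_insert, Finset.mem_singleton] at h ⊢
        rcases h with h | h
        · right; exact congrArg Subtype.val (hx ⟨v, hvT⟩ (hnb v x s hs h))
        · left; exact congrArg Subtype.val (hy ⟨v, hvT⟩ (hnb v y s hs h))
  · refine Or.inr (Or.inr (Or.inr ⟨?_, h⟩))
    rw [← hTc]
    apply pair_nonadj hD (x : G) y (fun h => hxy (Subtype.ext h))
    · intro v hv
      obtain ⟨s, hs, h⟩ := mem_nb.1 hv
      rw [Set.mem_toFinset]
      by_contra hvT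
      exact hx ⟨v, hvT⟩ (hnb v x s hs (by simpa using h))
    · intro v hv
      obtain ⟨s, hs, h⟩ := mem_nb.1 hv
      rw [Set.mem_toFinset]
      by_contra hvT
      exact hy ⟨v, hvT⟩ (hnb v y s hs (by simpa using h))

end CL

namespace CL
open Equiv

lemma swap_inj {α : Type*} [DecidableEq α] {a b c d : α} (h : a ≠ b) (he : swap a b = swap c d) :
    (a = c ∧ b = d) ∨ (a = d ∧ b = c) := by
  have h1 : swap c d a = b := by rw [← he, swap_apply_left]
  rw [swap_apply_def] at h1
  split_ifs at h1 with h2 h3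
  · exact Or.inl ⟨h2, h1.symm⟩
  · exact Or.inr ⟨h3, h1.symm⟩
  · exact absurd h1 h

lemma two_swaps {α : Type*} [DecidableEq α] {s t : Perm α} (hs : s.IsSwap) (ht : t.IsSwap)
    (hne : s ≠ t) :
    (∃ a b c, a ≠ b ∧ a ≠ c ∧ b ≠ c ∧ s = swap a b ∧ t = swap a c) ∨
    (∃ a b c d, a ≠ b ∧ a ≠ c ∧ a ≠ d ∧ b ≠ c ∧ b ≠ d ∧ c ≠ d ∧ s = swap a b ∧ t = swap c d) := by
  obtain ⟨a, b, hab, rfl⟩ := hs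
  obtain ⟨c, d, hcd, rfl⟩ := ht
  by_cases h1 : a = c
  · subst h1
    exact Or.inl ⟨a, b, d, hab, hcd, fun h => hne (by rw [h]), rfl, rfl⟩
  by_cases h2 : a = d
  · subst h2
    exact Or.inl ⟨a, b, c, hab, hcd.symm, fun h => hne (by rw [h, swap_comm]), rfl, swap_comm _ _⟩
  by_cases h3 : b = c
  · subst h3
    exact Or.inl ⟨b, a, d, hab.symm, hcd, h2, swap_comm _ _, rfl⟩
  by_cases h4 : b = d
  · subst h4
    exact Or.inl ⟨b, a, c, hab.symm, hcd.symm, h1, swap_comm _ _, swap_comm _ _⟩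
  exact Or.inr ⟨a, b, c, d, hab, h1, h2, h3, h4, hcd, rfl, rfl⟩

lemma swaps_pow {α : Type*} [DecidableEq α] [Fintype α] {s t : Perm α} (hs : s.IsSwap)
    (ht : t.IsSwap) : (s * t) ^ 6 = 1 := by
  have hsq : ∀ u : Perm α, u.IsSwap → u * u = 1 := by
    rintro u ⟨a, b, _, rfl⟩; exact swap_mul_self a b
  by_cases hne : s = t
  · rw [hne, hsq t ht, one_pow]
  rcases two_swaps hs ht hne with ⟨a, b, c, hab, hac, hbc, rfl, rfl⟩ |
    ⟨a, b, c, d, hab, hac, had, hbc, hbd, hcd, rfl, rfl⟩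
  · have h3 := (Perm.isThreeCycle_swap_mul_swap_same hab hac hbc).orderOf
    have : (swap a b * swap a c) ^ 3 = 1 := by rw [← h3]; exact pow_orderOf_eq_one _
    rw [show 6 = 3 * 2 from rfl, pow_mul, this, one_pow]
  · have hcomm : Commute (swap a b) (swap c d) :=
      (Perm.disjoint_swap_swap (by simp [*])).commute
    rw [hcomm.mul_pow, show 6 = 2 * 3 from rfl, pow_mul, pow_mul, pow_two, pow_two,
      swap_mul_self, swap_mul_self]
    simp

/-- a factor in a two-swap factorization is determined by a moved point -/
lemma factor_form {α : Type*} [DecidableEq α] {s t g : Perm α} (hs : s.IsSwap)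
    (ht : t.IsSwap) (hg : g ≠ 1) (h : s * t = g) : ∃ z, g z ≠ z ∧ s = swap z (g z) := by
  have hne : s ≠ t := by
    rintro rfl
    obtain ⟨a, b, _, rfl⟩ := hs
    rw [swap_mul_self] at h
    exact hg h.symm
  subst h
  rcases two_swaps hs ht hne with ⟨a, b, c, hab, hac, hbc, rfl, rfl⟩ |
    ⟨a, b, c, d, hab, hac, had, hbc, hbd, hcd, rfl, rfl⟩
  · have : (swap a b * swap a c) b = a := by
      rw [Perm.mul_apply, swap_apply_of_ne_of_ne hab.symm hbc, swap_apply_right]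
    exact ⟨b, by rw [this]; exact hab, by rw [this, swap_comm]⟩
  · have : (swap a b * swap c d) a = b := by
      rw [Perm.mul_apply, swap_apply_of_ne_of_ne hac had, swap_apply_left]
    exact ⟨a, by rw [this]; exact hab.symm, by rw [this]⟩

lemma rep_bound {n : ℕ} (S : Finset (Perm (Fin n))) (hS : ∀ t ∈ S, Perm.IsSwap t)
    (g : Perm (Fin n)) (hg : g ≠ 1) : rep S g ≤ 2 ∨ (rep S g ≤ 3 ∧ 
      ∃ a b c, a ≠ b ∧ a ≠ c ∧ b ≠ c ∧ swap a b ∈ S ∧ swap a c ∈ S ∧ swap b c ∈ S) := by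
  have hsq : ∀ u : Perm (Fin n), u.IsSwap → u⁻¹ = u := by
    rintro u ⟨a, b, _, rfl⟩; exact swap_inv a b
  obtain ⟨F, hF⟩ : ∃ F, F = S.filter (fun s => s⁻¹ * g ∈ S) := ⟨_, rfl⟩
  have hrep : rep S g = F.card := by rw [hF]; rfl
  rw [hrep]
  rcases F.eq_empty_or_nonempty with h0 | ⟨s₀, hs₀⟩
  · left; rw [h0]; simp
  have hmem : ∀ s, s ∈ F → s ∈ S ∧ s⁻¹ * g ∈ S := by
    intro s hs; rw [hF, Finset.mem_filter] at hs; exact hs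
  have hform : ∀ s ∈ F, ∃ z, g z ≠ z ∧ s = swap z (g z) := by
    intro s hs
    obtain ⟨h1, h2⟩ := hmem s hs
    exact factor_form (hS s h1) (hS _ h2) hg (by simp)
  obtain ⟨h1, h2⟩ := hmem s₀ hs₀
  obtain ⟨t₀, ht₀⟩ : ∃ t, t = s₀⁻¹ * g := ⟨_, rfl⟩
  rw [← ht₀] at h2
  have hgst : g = s₀ * t₀ := by rw [ht₀]; simp
  have hne : s₀ ≠ t₀ := by
    intro h
    apply hg
    rw [hgst, ← h]
    nth_rw 1 [← hsq s₀ (hS s₀ h1)]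
    simp
  rcases two_swaps (hS s₀ h1) (hS t₀ h2) hne with ⟨a, b, c, hab, hac, hbc, e1, e2⟩ |
    ⟨a, b, c, d, hab, hac, had, hbc, hbd, hcd, e1, e2⟩
  · have hsub : F ⊆ {swap a b, swap a c, swap b c} := by
      intro s hs
      obtain ⟨z, hz, rfl⟩ := hform s hs
      have ga : g a = c := by
        rw [hgst, e1, e2, Perm.mul_apply, swap_apply_left, swap_apply_of_ne_of_ne hac.symm hbc.symm]
      have gb : g b = a := by
        rw [hgst, e1, e2, Perm.mul_apply, swap_apply_of_ne_of_ne hab.symm hbc, swap_apply_right]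
      have gc : g c = b := by
        rw [hgst, e1, e2, Perm.mul_apply, swap_apply_right, swap_apply_left]
      have : z = a ∨ z = b ∨ z = c := by
        by_contra hcon
        push Not at hcon
        apply hz
        rw [hgst, e1, e2, Perm.mul_apply, swap_apply_of_ne_of_ne hcon.1 hcon.2.2,
          swap_apply_of_ne_of_ne hcon.1 hcon.2.1]
      rcases this with rfl | rfl | rfl
      · rw [ga]; simp
      · rw [gb, swap_comm]; simp
      · rw [gc, swap_comm z b]; simp
    have h3 : ({swap a b, swap a c, swap b c} : Finset (Perm (Fin n))).card ≤ 3 :=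
      Finset.card_le_three
    have hle := Finset.card_le_card hsub
    rcases Nat.lt_or_ge F.card 3 with h | h
    · left; omega
    · right
      have heq := Finset.eq_of_subset_of_card_le hsub (by omega)
      refine ⟨by omega, a, b, c, hab, hac, hbc, ?_, ?_, ?_⟩
      · exact (hmem _ (by rw [heq]; simp)).1
      · exact (hmem _ (by rw [heq]; simp)).1
      · exact (hmem _ (by rw [heq]; simp)).1
  · left
    have hsub : F ⊆ {swap a b, swap c d} := by
      intro s hs
      obtain ⟨z, hz, rfl⟩ := hform s hs
      have ga : g a = b := by
        rw [hgst, e1, e2, Perm.mul_apply, swap_apply_of_ne_of_ne hac had, swap_apply_left]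
      have gb : g b = a := by
        rw [hgst, e1, e2, Perm.mul_apply, swap_apply_of_ne_of_ne hbc hbd, swap_apply_right]
      have gc : g c = d := by
        rw [hgst, e1, e2, Perm.mul_apply, swap_apply_left, swap_apply_of_ne_of_ne had.symm hbd.symm]
      have gd : g d = c := by
        rw [hgst, e1, e2, Perm.mul_apply, swap_apply_right, swap_apply_of_ne_of_ne hac.symm hbc.symm]
      have : z = a ∨ z = b ∨ z = c ∨ z = d := by
        by_contra hcon
        push Not at hcon
        apply hz
        rw [hgst, e1, e2, Perm.mul_apply, swap_apply_of_ne_of_ne hcon.2.2.1 hcon.2.2.2,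
          swap_apply_of_ne_of_ne hcon.1 hcon.2.1]
      rcases this with rfl | rfl | rfl | rfl
      · rw [ga]; simp
      · rw [gb, swap_comm]; simp
      · rw [gc]; simp
      · rw [gd, swap_comm z c]; simp
    exact (Finset.card_le_card hsub).trans Finset.card_le_two

lemma trans_adj {n : ℕ} (S : Set (Perm (Fin n))) (i j : Fin n) :
    (transGraph S).Adj i j ↔ i ≠ j ∧ swap i j ∈ S := by
  rw [transGraph, SimpleGraph.fromRel_adj, swap_comm j i, or_self]

lemma closure_top {n : ℕ} (S : Set (Perm (Fin n))) (hconn : (transGraph S).Connected) :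
    Subgroup.closure S = ⊤ := by
  have hw : ∀ x y, (transGraph S).Walk x y → swap x y ∈ Subgroup.closure S := by
    intro x y w
    induction w with
    | nil => rw [swap_self]; exact one_mem _
    | cons h _ ih =>
      exact SubmonoidClass.swap_mem_trans _ (Subgroup.subset_closure ((trans_adj S _ _).1 h).2) ih
  rw [eq_top_iff, ← Perm.closure_isSwap, Subgroup.closure_le]
  rintro σ ⟨x, y, _, rfl⟩
  obtain ⟨w⟩ := hconn.preconnected x y
  exact hw x y w

lemma card_edges {n : ℕ} (S : Set (Perm (Fin n))) (hS : ∀ t ∈ S, Perm.IsSwap t) :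
    S.ncard = (transGraph S).edgeSet.ncard := by
  let f : Sym2 (Fin n) → Perm (Fin n) := Sym2.lift ⟨fun a b => swap a b, fun a b => swap_comm a b⟩
  have hf : ∀ a b, f s(a, b) = swap a b := fun a b => rfl
  have himg : S = f '' (transGraph S).edgeSet := by
    ext t
    constructor
    · intro ht
      obtain ⟨a, b, hab, rfl⟩ := hS t ht
      exact ⟨s(a, b), (SimpleGraph.mem_edgeSet _).2 ((trans_adj S a b).2 ⟨hab, ht⟩), rfl⟩
    · rintro ⟨e, he, rfl⟩
      induction e using Sym2.ind with
      | _ a b => exact ((trans_adj S a b).1 he).2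
  conv_lhs => rw [himg]
  apply Set.ncard_image_of_injOn
  intro e he e' he' h
  induction e using Sym2.ind with
  | _ a b =>
    induction e' using Sym2.ind with
    | _ c d =>
      rw [hf, hf] at h
      rw [Sym2.eq_iff]
      exact swap_inj ((trans_adj S a b).1 he).1 h

lemma size_bound {n : ℕ} (H : SimpleGraph (Fin n)) (h7 : 7 ≤ H.edgeSet.ncard) :
    2 * H.edgeSet.ncard + 5 ≤ Fintype.card (Perm (Fin n)) := by
  classical
  have h1 : H.edgeSet.ncard ≤ n.choose 2 := by
    have := H.card_edgeFinset_le_card_choose_two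
    rw [Fintype.card_fin] at this
    rwa [Set.ncard_eq_toFinset_card']
  rw [Fintype.card_perm, Fintype.card_fin]
  have h5 : 5 ≤ n := by
    by_contra h
    have : n.choose 2 ≤ Nat.choose 4 2 := Nat.choose_le_choose 2 (by omega)
    have : Nat.choose 4 2 = 6 := by decide
    omega
  obtain ⟨r, rfl⟩ : ∃ r, n = r + 2 := ⟨n - 2, by omega⟩
  have hf : (r + 2).factorial = (r + 2) * ((r + 1) * r.factorial) := by
    rw [Nat.factorial_succ, Nat.factorial_succ]
  have h6 : 6 ≤ r.factorial := by
    have : Nat.factorial 3 ≤ r.factorial := Nat.factorial_le (by omega)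
    exact this
  have hch : 2 * (r + 2).choose 2 = (r + 2) * (r + 1) := by
    rw [Nat.choose_two_right]
    exact Nat.mul_div_cancel' (Nat.even_mul_pred_self (r + 2)).two_dvd
  rw [hf, ← mul_assoc]
  have : (r + 2) * (r + 1) * 6 ≤ (r + 2) * (r + 1) * r.factorial := Nat.mul_le_mul_left _ h6
  omega

end CL

/-- Cheng–Lipták: for the Cayley graph of a connected transposition generating graph
with `m ≥ 7` edges and a vertex set `T` with `|T| ≤ 2m-2` (triangle-free case)
resp. `|T| ≤ 2m-3` (triangle case), one of five structural conclusions about the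
components of `G - T` holds. -/
theorem stmt5 (n m : ℕ) (S : Set (Equiv.Perm (Fin n))) (hS : ∀ t ∈ S, Equiv.Perm.IsSwap t)
    (hconn : (transGraph S).Connected)
    (hm : (transGraph S).edgeSet.ncard = m) (hm7 : 7 ≤ m)
    (T : Set (Equiv.Perm (Fin n)))
    (hT1 : ¬ hasTriangle (transGraph S) → T.ncard ≤ 2 * m - 2)
    (hT2 : hasTriangle (transGraph S) → T.ncard ≤ 2 * m - 3) :
    ((cayley S).induce (Tᶜ : Set (Equiv.Perm (Fin n)))).Connected ∨
    (¬ ((cayley S).induce (Tᶜ : Set (Equiv.Perm (Fin n)))).Connected ∧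
      Nat.card ((cayley S).induce (Tᶜ : Set (Equiv.Perm (Fin n)))).ConnectedComponent = 2 ∧
      ∃ c : ((cayley S).induce (Tᶜ : Set (Equiv.Perm (Fin n)))).ConnectedComponent,
        c.supp.ncard = 1) ∨
    (¬ hasTriangle (transGraph S) ∧
      ¬ ((cayley S).induce (Tᶜ : Set (Equiv.Perm (Fin n)))).Connected ∧
      Nat.card ((cayley S).induce (Tᶜ : Set (Equiv.Perm (Fin n)))).ConnectedComponent = 2 ∧
      (∃ c : ((cayley S).induce (Tᶜ : Set (Equiv.Perm (Fin n)))).ConnectedComponent,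
        c.supp.ncard = 2) ∧
      T.ncard = 2 * m - 2) ∨
    (¬ hasTriangle (transGraph S) ∧
      ¬ ((cayley S).induce (Tᶜ : Set (Equiv.Perm (Fin n)))).Connected ∧
      Nat.card ((cayley S).induce (Tᶜ : Set (Equiv.Perm (Fin n)))).ConnectedComponent = 3 ∧
      (∃ c₁ c₂ : ((cayley S).induce (Tᶜ : Set (Equiv.Perm (Fin n)))).ConnectedComponent,
        c₁ ≠ c₂ ∧ c₁.supp.ncard = 1 ∧ c₂.supp.ncard = 1) ∧
      T.ncard = 2 * m - 2) ∨
    (hasTriangle (transGraph S) ∧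
      ¬ ((cayley S).induce (Tᶜ : Set (Equiv.Perm (Fin n)))).Connected ∧
      Nat.card ((cayley S).induce (Tᶜ : Set (Equiv.Perm (Fin n)))).ConnectedComponent = 3 ∧
      (∃ c₁ c₂ : ((cayley S).induce (Tᶜ : Set (Equiv.Perm (Fin n)))).ConnectedComponent,
        c₁ ≠ c₂ ∧ c₁.supp.ncard = 1 ∧ c₂.supp.ncard = 1) ∧
      T.ncard = 2 * m - 3) := by
  classical
  have hcS := CL.card_edges S hS
  rw [hm] at hcS
  have hcF : S.toFinset.card = m := by rw [← hcS, Set.ncard_eq_toFinset_card']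
  have hsq : ∀ t ∈ S, t * t = 1 := by
    intro t ht
    obtain ⟨a, b, _, rfl⟩ := hS t ht
    exact Equiv.swap_mul_self a b
  have hsize := CL.size_bound (transGraph S) (by omega)
  rw [hm] at hsize
  have hSF : ∀ t ∈ S.toFinset, Equiv.Perm.IsSwap t := fun t ht => hS t (Set.mem_toFinset.1 ht)
  have hadj : ∀ x y, (cayley S).Adj x y ↔ ∃ s ∈ S.toFinset, y = x * s := by
    intro x y
    rw [cayley, SimpleGraph.fromRel_adj]
    constructor
    · rintro ⟨_, ⟨t, ht, h⟩ | ⟨t, ht, h⟩⟩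
      · exact ⟨t, Set.mem_toFinset.2 ht, h⟩
      · exact ⟨t, Set.mem_toFinset.2 ht, by rw [h, mul_assoc, hsq t ht, mul_one]⟩
    · rintro ⟨t, ht, h⟩
      rw [Set.mem_toFinset] at ht
      refine ⟨?_, Or.inl ⟨t, ht, h⟩⟩
      intro hxy
      rw [← hxy] at h
      have h1 : t = 1 := by simpa using h.symm
      obtain ⟨a, b, hab, h2⟩ := hS t ht
      rw [h1] at h2
      exact hab (Equiv.swap_eq_one_iff.1 h2.symm)
  have mk : ∀ c K : ℕ, (∀ g : Equiv.Perm (Fin n), g ≠ 1 → CL.rep S.toFinset g ≤ c) →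
      ((c = 2 ∧ K = 2 * m - 2) ∨ (c = 3 ∧ K = 2 * m - 3)) →
      CL.Dat S.toFinset Equiv.Perm.sign c K := by
    intro c K hr hcK
    refine ⟨fun s hs => hsq s (Set.mem_toFinset.1 hs), fun s hs => (hSF s hs).sign_eq, ?_, hr,
      fun s hs t ht => CL.swaps_pow (hSF s hs) (hSF t ht), by omega, by rw [hcF]; exact hcK⟩
    rw [Set.coe_toFinset]
    exact CL.closure_top S hconn
  by_cases htri : hasTriangle (transGraph S)
  · have hT := hT2 htri
    have hD := mk 3 (2 * m - 3) (fun g hg => by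
      rcases CL.rep_bound S.toFinset hSF g hg with h | h <;> omega) (Or.inr ⟨rfl, rfl⟩)
    rcases CL.abs_main hD (cayley S) hadj T hT (by omega) with h | h | ⟨h1, h⟩ | ⟨h1, h2, h3, h4⟩
    · exact Or.inl h
    · exact Or.inr (Or.inl h)
    · omega
    · exact Or.inr (Or.inr (Or.inr (Or.inr ⟨htri, h2, h3, h4, by omega⟩)))
  · have hT := hT1 htri
    have hD := mk 2 (2 * m - 2) (fun g hg => by
      rcases CL.rep_bound S.toFinset hSF g hg with h | ⟨_, a, b, c, hab, hac, hbc, h1, h2, h3⟩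
      · exact h
      · refine absurd ⟨a, b, c, ?_, ?_, ?_⟩ htri
        · exact (CL.trans_adj S a b).2 ⟨hab, Set.mem_toFinset.1 h1⟩
        · exact (CL.trans_adj S a c).2 ⟨hac, Set.mem_toFinset.1 h2⟩
        · exact (CL.trans_adj S b c).2 ⟨hbc, Set.mem_toFinset.1 h3⟩) (Or.inl ⟨rfl, rfl⟩)
    rcases CL.abs_main hD (cayley S) hadj T hT (by omega) with h | h | ⟨h1, h2, h3, h4⟩ |
      ⟨h1, h2, h3, h4⟩
    · exact Or.inl h
    · exact Or.inr (Or.inl h)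
    · exact Or.inr (Or.inr (Or.inl ⟨htri, h2, h3, h4, by omega⟩))
    · exact Or.inr (Or.inr (Or.inr (Or.inl ⟨htri, h2, h3, h4, by omega⟩)))
end

section
/- For n ≥ 5, the R_2-vertex-connectivity of the complete transposition graph CT_n satisfies κ^2(CT_n) = 2n(n−1) − 10. -/
open Equiv Equiv.Perm Finset

open Classical in
/-- neighbours of `g` in the complete transposition graph -/
noncomputable def nb {n : ℕ} (g : Perm (Fin n)) : Finset (Perm (Fin n)) :=
  univ.filter (fun h => (g⁻¹ * h).IsSwap)

lemma mem_nb {n : ℕ} {g h : Perm (Fin n)} : h ∈ nb g ↔ (g⁻¹ * h).IsSwap := by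
  simp [nb]

lemma isSwap_inv {n : ℕ} {t : Perm (Fin n)} (h : t.IsSwap) : t⁻¹.IsSwap := by
  obtain ⟨x, y, hxy, rfl⟩ := h
  exact ⟨x, y, hxy, by simp⟩

lemma mem_nb_comm {n : ℕ} {g h : Perm (Fin n)} : h ∈ nb g ↔ g ∈ nb h := by
  rw [mem_nb, mem_nb]
  constructor <;> intro h1 <;> simpa using isSwap_inv h1

lemma cayley_adj {n : ℕ} (g h : Perm (Fin n)) :
    (cayley {t : Perm (Fin n) | t.IsSwap}).Adj g h ↔ h ∈ nb g := by
  unfold cayley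
  rw [SimpleGraph.fromRel_adj, mem_nb]
  constructor
  · rintro ⟨_, ⟨t, ht, rfl⟩ | ⟨t, ht, rfl⟩⟩
    · simpa using ht
    · simpa using isSwap_inv ht
  · intro hs
    refine ⟨?_, Or.inl ⟨_, hs, by simp⟩⟩
    rintro rfl
    obtain ⟨x, y, hxy, h⟩ := hs
    rw [inv_mul_cancel] at h
    exact hxy (swap_eq_one_iff.mp h.symm)

lemma sign_nb {n : ℕ} {g h : Perm (Fin n)} (hh : h ∈ nb g) : sign h = - sign g := by
  have h1 := (mem_nb.mp hh).sign_eq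
  rw [Perm.sign_mul, sign_inv] at h1
  rcases Int.units_eq_one_or (sign g) with h2 | h2 <;>
  rcases Int.units_eq_one_or (sign h) with h3 | h3 <;> simp_all

lemma card_nb {n : ℕ} (g : Perm (Fin n)) : (nb g).card = n.choose 2 := by
  classical
  have : (nb g).card = (powersetCard 2 (univ : Finset (Fin n))).card := by
    refine card_bij (fun h _ => (g⁻¹ * h).support) ?_ ?_ ?_
    · intro h hh
      rw [mem_powersetCard]
      exact ⟨subset_univ _, card_support_eq_two.mpr (mem_nb.mp hh)⟩
    · intro a ha b hb hab
      have hab' : (g⁻¹ * a).support = (g⁻¹ * b).support := hab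
      obtain ⟨x, y, hxy, h1⟩ := mem_nb.mp ha
      obtain ⟨z, w, hzw, h2⟩ := mem_nb.mp hb
      rw [h1, h2, support_swap hxy, support_swap hzw] at hab'
      have : swap x y = swap z w := by
        have hz : z ∈ ({x, y} : Finset (Fin n)) := by rw [hab']; simp
        have hw : w ∈ ({x, y} : Finset (Fin n)) := by rw [hab']; simp
        simp only [mem_insert, mem_singleton] at hz hw
        rcases hz with rfl | rfl <;> rcases hw with rfl | rfl
        · exact absurd rfl hzw
        · rfl
        · exact swap_comm _ _
        · exact absurd rfl hzw
      have h3 : g⁻¹ * a = g⁻¹ * b := by rw [h1, h2, this]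
      exact mul_left_cancel h3
    · intro s hs
      rw [mem_powersetCard] at hs
      obtain ⟨x, y, hxy, rfl⟩ := card_eq_two.mp hs.2
      refine ⟨g * swap x y, mem_nb.mpr ⟨x, y, hxy, by simp⟩, ?_⟩
      simp [support_swap hxy]
  rw [this, card_powersetCard, card_univ, Fintype.card_fin]

lemma two_swap {n : ℕ} {t₁ t₂ σ : Perm (Fin n)} (h1 : t₁.IsSwap) (h2 : t₂.IsSwap)
    (h : t₂ * t₁ = σ) (a : Fin n) (ha : σ a ≠ a) :
    t₁ = swap a (σ a) ∨ t₁ = swap a (σ⁻¹ a) ∨ t₁ = swap a (σ a) * σ := by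
  by_cases h3 : t₁ a = a
  · right; right
    have h4 : t₂ a = σ a := by rw [← h]; simp [h3]
    have h5 : t₂ = swap a (σ a) := by
      rw [← h4]
      obtain ⟨x, y, hxy, rfl⟩ := h2
      have : swap x y a ≠ a := by rw [h4]; exact ha
      rcases (swap_apply_ne_self_iff.mp this).2 with rfl | rfl
      · simp
      · simp [swap_comm]
    rw [← h5, ← h]
    obtain ⟨x, y, hxy, rfl⟩ := h2
    simp [← mul_assoc]
  · have h4 : t₁ = swap a (t₁ a) := by
      obtain ⟨x, y, hxy, rfl⟩ := h1
      rcases (swap_apply_ne_self_iff.mp h3).2 with rfl | rfl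
      · simp
      · simp [swap_comm]
    set y := t₁ a with hy
    have h5 : t₂ y = σ a := by rw [← h]; simp [hy]
    by_cases h6 : t₂ y = y
    · left; rw [h4, ← h5, h6]
    · right; left
      have h7 : t₂ a = a := by
        obtain ⟨x, z, hxz, rfl⟩ := h2
        by_contra h8
        have h9 := (swap_apply_ne_self_iff.mp h8).2
        have h10 := (swap_apply_ne_self_iff.mp h6).2
        rcases h9 with rfl | rfl <;> rcases h10 with h10 | h10
        · exact h3 h10
        · rw [h10, swap_apply_right] at h5; exact ha h5.symm
        · rw [h10, swap_apply_left] at h5; exact ha h5.symm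
        · exact h3 h10
      have h8 : σ y = a := by
        rw [← h, Perm.mul_apply, h4, swap_apply_right, h7]
      rw [h4, ← h8]; simp

lemma codeg {n : ℕ} {g h : Perm (Fin n)} (hgh : g ≠ h) : (nb g ∩ nb h).card ≤ 3 := by
  classical
  have h1 : h⁻¹ * g ≠ 1 := by
    intro h2; exact hgh (inv_mul_eq_one.mp h2).symm
  obtain ⟨a, ha⟩ : ∃ a, (h⁻¹ * g) a ≠ a := by
    by_contra! hc
    exact h1 (Equiv.ext hc)
  set σ := h⁻¹ * g with hσ
  have : nb g ∩ nb h ⊆ ({g * swap a (σ a), g * swap a (σ⁻¹ a), g * (swap a (σ a) * σ)} :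
      Finset (Perm (Fin n))) := by
    intro x hx
    rw [mem_inter, mem_nb, mem_nb] at hx
    obtain ⟨hx1, hx2⟩ := hx
    have h3 := two_swap (t₁ := g⁻¹ * x) (t₂ := h⁻¹ * x) (σ := σ) hx1 hx2 (by
      obtain ⟨z, w, hzw, hs⟩ := hx1
      have : g⁻¹ * x = x⁻¹ * g := by
        have h4 : (g⁻¹ * x)⁻¹ = g⁻¹ * x := by rw [hs]; simp
        rw [← h4]; simp
      rw [this, hσ]; group) a ha
    simp only [mem_insert, mem_singleton]
    rcases h3 with h3 | h3 | h3
    · left; rw [← h3]; simp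
    · right; left; rw [← h3]; simp
    · right; right; rw [← h3]; simp
  exact (card_le_card this).trans card_le_three

lemma half_card {n : ℕ} (hn : 2 ≤ n) (s : ℤˣ) :
    2 * (univ.filter (fun g : Perm (Fin n) => sign g = s)).card = n.factorial := by
  classical
  have key : ∀ s : ℤˣ, (univ.filter (fun g : Perm (Fin n) => sign g = s)).card =
      (univ.filter (fun g : Perm (Fin n) => ¬ sign g = s)).card := by
    intro s
    let a : Fin n := ⟨0, by omega⟩
    let b : Fin n := ⟨1, by omega⟩
    have hab : a ≠ b := by simp [a, b]
    refine card_bij (fun g _ => g * swap a b) ?_ ?_ ?_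
    · intro g hg
      simp only [mem_filter, mem_univ, true_and] at hg ⊢
      rw [Perm.sign_mul, sign_swap hab, hg]
      rcases Int.units_eq_one_or s with h | h <;> rw [h] <;> decide
    · intro x _ y _ hxy
      exact mul_right_cancel hxy
    · intro g hg
      simp only [mem_filter, mem_univ, true_and] at hg
      refine ⟨g * swap a b, ?_, by simp [mul_assoc]⟩
      simp only [mem_filter, mem_univ, true_and]
      rw [Perm.sign_mul, sign_swap hab]
      rcases Int.units_eq_one_or s with h | h <;>
      rcases Int.units_eq_one_or (sign g) with h' | h' <;> simp_all
  have h2 := card_filter_add_card_filter_not (s := (univ : Finset (Perm (Fin n)))) (fun g => sign g = s)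
  rw [card_univ, Fintype.card_perm, Fintype.card_fin] at h2
  have := key s
  omega

/-- non-adjacent sets of opposite parity -/
def Opp {n : ℕ} (E E' : Finset (Perm (Fin n))) : Prop :=
  ∃ s : ℤˣ, (∀ g ∈ E, sign g = s) ∧ (∀ g ∈ E', sign g = -s) ∧ ∀ g ∈ E, ∀ h ∈ E', h ∉ nb g

lemma Opp.symm {n : ℕ} {E E' : Finset (Perm (Fin n))} (h : Opp E E') : Opp E' E := by
  obtain ⟨s, h1, h2, h3⟩ := h
  exact ⟨-s, h2, by simpa using h1, fun g hg k hk h4 => h3 k hk g hg (mem_nb_comm.mp h4)⟩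

lemma Opp.bound {n : ℕ} (hn : 2 ≤ n) {E E' : Finset (Perm (Fin n))} (h : Opp E E')
    (N : Finset (Perm (Fin n))) (hN : ∀ x ∈ N, ∃ g ∈ E, x ∈ nb g) :
    2 * (N.card + E'.card) ≤ n.factorial := by
  classical
  obtain ⟨s, h1, h2, h3⟩ := h
  rw [← half_card hn (-s), ← card_union_of_disjoint]
  · refine Nat.mul_le_mul_left _ (card_le_card ?_)
    intro x hx
    simp only [mem_filter, mem_univ, true_and]
    rcases mem_union.mp hx with hx | hx
    · obtain ⟨g, hg, hx⟩ := hN x hx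
      rw [sign_nb hx, h1 g hg]
    · exact h2 x hx
  · rw [Finset.disjoint_left]
    intro x hx hx'
    obtain ⟨g, hg, hx⟩ := hN x hx
    exact h3 g hg x hx' hx

lemma Opp.bound1 {n : ℕ} (hn : 2 ≤ n) {E E' : Finset (Perm (Fin n))} (h : Opp E E')
    (hE : 1 ≤ E.card) : 2 * (n.choose 2 + E'.card) ≤ n.factorial := by
  obtain ⟨g, hg⟩ := card_pos.mp hE
  have := h.bound hn (nb g) (fun x hx => ⟨g, hg, hx⟩)
  rwa [card_nb] at this

lemma Opp.bound2 {n : ℕ} (hn : 2 ≤ n) {E E' : Finset (Perm (Fin n))} (h : Opp E E')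
    (hE : 2 ≤ E.card) : 2 * (2 * n.choose 2 + E'.card) ≤ n.factorial + 6 := by
  classical
  obtain ⟨g, hg, k, hk, hgk⟩ := one_lt_card.mp hE
  have h1 := h.bound hn (nb g ∪ nb k) (by
    intro x hx
    rcases mem_union.mp hx with hx | hx
    exacts [⟨g, hg, hx⟩, ⟨k, hk, hx⟩])
  have h2 := card_union_add_card_inter (nb g) (nb k)
  have h3 := codeg hgk
  rw [card_nb, card_nb] at h2
  omega

lemma Opp.bound3 {n : ℕ} (hn : 2 ≤ n) {E E' : Finset (Perm (Fin n))} (h : Opp E E')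
    (hE : 3 ≤ E.card) : 2 * (3 * n.choose 2 + E'.card) ≤ n.factorial + 18 := by
  classical
  obtain ⟨g, k, l, hg, hk, hl, hgk, hgl, hkl⟩ := two_lt_card_iff.mp hE
  have h1 := h.bound hn ((nb g ∪ nb k) ∪ nb l) (by
    intro x hx
    simp only [mem_union] at hx
    rcases hx with (hx | hx) | hx
    exacts [⟨g, hg, hx⟩, ⟨k, hk, hx⟩, ⟨l, hl, hx⟩])
  have h2 := card_union_add_card_inter (nb g) (nb k)
  have h4 := card_union_add_card_inter (nb g ∪ nb k) (nb l)
  rw [union_inter_distrib_right] at h4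
  have h5 := card_union_le (nb g ∩ nb l) (nb k ∩ nb l)
  have h3 := codeg hgk
  have h6 := codeg hgl
  have h7 := codeg hkl
  rw [card_nb, card_nb] at h2
  rw [card_nb] at h4
  omega

/-- slice of `E` -/
def sl {n : ℕ} (i : Fin (n + 1)) (E : Finset (Perm (Fin (n + 1)))) : Finset (Perm (Fin n)) :=
  univ.filter (fun e => decomposeFin.symm (i, e) ∈ E)

lemma mem_sl {n : ℕ} {i : Fin (n + 1)} {E : Finset (Perm (Fin (n + 1)))} {e : Perm (Fin n)} :
    e ∈ sl i E ↔ decomposeFin.symm (i, e) ∈ E := by simp [sl]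

lemma sum_sl {n : ℕ} (E : Finset (Perm (Fin (n + 1)))) : ∑ i, (sl i E).card = E.card := by
  rw [← card_sigma]
  refine card_bij (fun p _ => decomposeFin.symm (p.1, p.2)) ?_ ?_ ?_
  · intro p hp
    exact mem_sl.mp (mem_sigma.mp hp).2
  · rintro ⟨a, b⟩ _ ⟨c, d⟩ _ h
    have := decomposeFin.symm.injective h
    simp only [Prod.mk.injEq] at this
    obtain ⟨rfl, rfl⟩ := this
    rfl
  · intro g hg
    refine ⟨⟨(decomposeFin g).1, (decomposeFin g).2⟩, ?_, by simp⟩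
    simp [mem_sl, hg]

lemma dec_mul {n : ℕ} (i : Fin (n + 1)) (e : Perm (Fin n)) (x y : Fin n) :
    decomposeFin.symm (i, e * swap x y) = decomposeFin.symm (i, e) * swap x.succ y.succ := by
  ext z
  congr 1
  refine Fin.cases ?_ (fun z => ?_) z
  · rw [decomposeFin_symm_apply_zero, Perm.mul_apply, swap_apply_of_ne_of_ne
      (Fin.succ_ne_zero x).symm (Fin.succ_ne_zero y).symm, decomposeFin_symm_apply_zero]
  · have : swap x.succ y.succ z.succ = (swap x y z).succ := by
      simp only [swap_apply_def, Fin.succ_inj]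
      split_ifs <;> rfl
    rw [decomposeFin_symm_apply_succ]
    change _ = decomposeFin.symm (i, e) (swap x.succ y.succ z.succ)
    rw [this, decomposeFin_symm_apply_succ]
    rfl

lemma sl_opp {n : ℕ} (i : Fin (n + 1)) {E E' : Finset (Perm (Fin (n + 1)))} (h : Opp E E') :
    Opp (sl i E) (sl i E') := by
  obtain ⟨s, h1, h2, h3⟩ := h
  have hu : ∀ g : Perm (Fin n), sign g = (if i = 0 then 1 else -1) *
      sign (decomposeFin.symm (i, g)) := by
    intro g
    rw [decomposeFin.symm_sign]
    split_ifs <;> simp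
  refine ⟨(if i = 0 then 1 else -1) * s, ?_, ?_, ?_⟩
  · intro g hg
    rw [hu, h1 _ (mem_sl.mp hg)]
  · intro g hg
    rw [hu, h2 _ (mem_sl.mp hg), mul_neg]
  · intro g hg k hk hgk
    refine h3 _ (mem_sl.mp hg) _ (mem_sl.mp hk) ?_
    obtain ⟨x, y, hxy, hs⟩ := mem_nb.mp hgk
    have : k = g * swap x y := by rw [← hs]; simp
    rw [this, dec_mul, mem_nb]
    exact ⟨x.succ, y.succ, by simpa using hxy, by simp⟩

lemma sl_cross {n : ℕ} (hn : 2 ≤ n) {i j : Fin (n + 1)} (hij : i ≠ j)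
    {E E' : Finset (Perm (Fin (n + 1)))} (h : Opp E E') :
    2 * ((sl i E).card + (sl j E').card) ≤ n.factorial := by
  classical
  obtain ⟨s, h1, h2, h3⟩ := h
  have hu : ∀ g : Perm (Fin n), sign g = (if j = 0 then 1 else -1) *
      sign (decomposeFin.symm (j, g)) := by
    intro g
    rw [decomposeFin.symm_sign]
    split_ifs <;> simp
  let φ : Perm (Fin n) → Perm (Fin n) := fun e =>
    (decomposeFin (swap i j * decomposeFin.symm (i, e))).2
  have hφ : ∀ e, decomposeFin.symm (j, φ e) = swap i j * decomposeFin.symm (i, e) := by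
    intro e
    have h4 : ∀ g : Perm (Fin (n + 1)), (decomposeFin g).1 = g 0 := by
      intro g
      obtain ⟨⟨p, e⟩, rfl⟩ := decomposeFin.symm.surjective g
      simp
    rw [Equiv.symm_apply_eq]
    refine Prod.ext ?_ rfl
    rw [h4]
    simp
  have hinj : Function.Injective φ := by
    intro a b hab
    have h4 := hφ a
    rw [hab, hφ b] at h4
    have := decomposeFin.symm.injective (mul_left_cancel h4)
    simpa using this.symm
  rw [← card_image_of_injective (sl i E) hinj, ← half_card hn ((if j = 0 then 1 else -1) * -s),
    ← card_union_of_disjoint]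
  · refine Nat.mul_le_mul_left _ (card_le_card ?_)
    intro x hx
    simp only [mem_filter, mem_univ, true_and]
    rw [hu]
    congr 1
    rcases mem_union.mp hx with hx | hx
    · obtain ⟨e, he, rfl⟩ := mem_image.mp hx
      rw [hφ, Perm.sign_mul, sign_swap hij, h1 _ (mem_sl.mp he)]
      simp
    · exact h2 _ (mem_sl.mp hx)
  · rw [Finset.disjoint_left]
    intro x hx hx'
    obtain ⟨e, he, rfl⟩ := mem_image.mp hx
    refine h3 _ (mem_sl.mp he) _ (mem_sl.mp hx') ?_
    rw [hφ, mem_nb]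
    set g := decomposeFin.symm (i, e)
    refine ⟨g⁻¹ i, g⁻¹ j, by simpa using hij, ?_⟩
    rw [swap_mul_eq_mul_swap]
    simp

lemma fact_bound (n : ℕ) (hn : 4 ≤ n) :
    4 * n.choose 2 ≤ n.factorial + 2 ∧ 6 ≤ n.choose 2 ∧ n + 2 ≤ n.choose 2 := by
  induction n, hn using Nat.le_induction with
  | base => decide
  | succ n hn ih =>
    have h1 : (n + 1).choose 2 = n + n.choose 2 := by
      rw [Nat.choose_succ_succ' n 1, Nat.choose_one_right]
    rw [h1, Nat.factorial_succ]
    have h2 : 4 * n.factorial ≤ n * n.factorial := Nat.mul_le_mul_right _ hn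
    rw [add_mul]
    omega

lemma base_four {E E' : Finset (Perm (Fin 4))} (h : Opp E E') (hE : 2 ≤ E.card)
    (hE' : 2 ≤ E'.card) : 2 * (E.card + E'.card + 2 * Nat.choose 4 2) ≤ Nat.factorial 4 + 10 := by
  have c4 : Nat.choose 4 2 = 6 := by decide
  have f4 : Nat.factorial 4 = 24 := by decide
  have f3 : Nat.factorial 3 = 6 := by decide
  have c3 : Nat.choose 3 2 = 3 := by decide
  have h1 := h.bound2 (by norm_num) hE
  have h2 := h.symm.bound2 (by norm_num) hE'
  have h3 := sum_sl E
  have h4 := sum_sl E'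
  have hx : ∀ i j : Fin 4, i ≠ j → (sl i E).card + (sl j E').card ≤ 3 := by
    intro i j hij
    have := sl_cross (by norm_num) hij h
    omega
  have hm : ∀ i : Fin 4, (sl i E).card = 0 ∨ (sl i E').card = 0 := by
    intro i
    by_contra! hc
    have := (sl_opp i h).bound1 (by norm_num) (by omega)
    omega
  rw [Fin.sum_univ_four] at h3 h4
  have x01 := hx 0 1 (by decide)
  have x02 := hx 0 2 (by decide)
  have x03 := hx 0 3 (by decide)
  have x10 := hx 1 0 (by decide)
  have x12 := hx 1 2 (by decide)
  have x13 := hx 1 3 (by decide)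
  have x20 := hx 2 0 (by decide)
  have x21 := hx 2 1 (by decide)
  have x23 := hx 2 3 (by decide)
  have x30 := hx 3 0 (by decide)
  have x31 := hx 3 1 (by decide)
  have x32 := hx 3 2 (by decide)
  have m0 := hm 0
  have m1 := hm 1
  have m2 := hm 2
  have m3 := hm 3
  omega

lemma small_case {n : ℕ} (hn : 4 ≤ n) {E E' : Finset (Perm (Fin (n + 1)))} (h : Opp E E')
    (hE : 2 ≤ E.card) (hs : ∀ i, (sl i E).card ≤ 1) :
    2 * (E.card + E'.card + 2 * (n + 1).choose 2) ≤ (n + 1).factorial + 10 := by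
  have h1 : E.card ≤ n + 1 := by
    rw [← sum_sl]
    calc _ ≤ ∑ i : Fin (n + 1), 1 := Finset.sum_le_sum (fun i _ => hs i)
      _ = n + 1 := by simp
  have hb := fact_bound n hn
  have hc : (n + 1).choose 2 = n + n.choose 2 := by
    rw [Nat.choose_succ_succ' n 1, Nat.choose_one_right]
  by_cases h2 : E.card = 2
  · have := h.bound2 (by omega) hE
    omega
  · have := h.bound3 (by omega) (by omega)
    omega

lemma main_bound (n : ℕ) (hn : 4 ≤ n) : ∀ E E' : Finset (Perm (Fin n)), Opp E E' →
    2 ≤ E.card → 2 ≤ E'.card →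
    2 * (E.card + E'.card + 2 * n.choose 2) ≤ n.factorial + 10 := by
  induction n, hn using Nat.le_induction with
  | base => exact fun E E' h h1 h2 => base_four h h1 h2
  | succ n hn ih =>
    intro E E' h hE hE'
    by_cases hs : ∀ i, (sl i E).card ≤ 1
    · exact small_case hn h hE hs
    by_cases hs' : ∀ i, (sl i E').card ≤ 1
    · have := small_case hn h.symm hE' hs'
      omega
    push Not at hs hs'
    obtain ⟨p, hp⟩ := hs
    obtain ⟨q, hq⟩ := hs'
    obtain ⟨b1, b2, b3⟩ := fact_bound n hn
    have hc : (n + 1).choose 2 = n + n.choose 2 := by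
      rw [Nat.choose_succ_succ' n 1, Nat.choose_one_right]
    have hx : ∀ i j, i ≠ j → 2 * ((sl i E).card + (sl j E').card) ≤ n.factorial :=
      fun i j hij => sl_cross (by omega) hij h
    have h22 : ∀ i, 2 ≤ (sl i E).card → 2 ≤ (sl i E').card →
        2 * ((sl i E).card + (sl i E').card + 2 * n.choose 2) ≤ n.factorial + 10 :=
      fun i => ih _ _ (sl_opp i h)
    have h1 : ∀ i, 1 ≤ (sl i E).card → 2 * (n.choose 2 + (sl i E').card) ≤ n.factorial :=
      fun i => (sl_opp i h).bound1 (by omega)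
    have h1' : ∀ i, 1 ≤ (sl i E').card → 2 * (n.choose 2 + (sl i E).card) ≤ n.factorial :=
      fun i => (sl_opp i h).symm.bound1 (by omega)
    have hD : ∀ i, 2 * ((sl i E).card + (sl i E').card) + 4 ≤ n.factorial := by
      intro i
      by_cases hi : (sl i E).card = 0
      · have : p ≠ i := by rintro rfl; omega
        have := hx p i this
        omega
      by_cases hi' : (sl i E').card = 0
      · have : i ≠ q := by rintro rfl; omega
        have := hx i q this
        omega
      have a1 := h1 i (by omega)
      have a2 := h1' i (by omega)
      have a3 := h22 i
      omega
    let G : Fin (n + 1) → ℤ := fun i =>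
      (n.factorial : ℤ) - 2 * ((sl i E).card + (sl i E').card) - 4
    have hG : ∀ i, 0 ≤ G i := by
      intro i
      have := hD i
      simp only [G]
      omega
    have hsum : ∑ i, G i = ((n + 1).factorial : ℤ) - 2 * (E.card + E'.card) - 4 * (n + 1) := by
      simp only [G, Finset.sum_sub_distrib, ← Finset.mul_sum, Finset.sum_add_distrib]
      rw [← sum_sl E, ← sum_sl E', Nat.factorial_succ]
      simp
      ring
    suffices hfin : (4 * n.choose 2 : ℤ) - 14 ≤ ∑ i, G i by
      rw [hsum] at hfin
      omega
    by_cases h2 : ∃ i, 2 ≤ (sl i E).card ∧ 2 ≤ (sl i E').card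
    · obtain ⟨i, hi, hi'⟩ := h2
      have a := h22 i hi hi'
      have a2 : G i ≤ ∑ i, G i := Finset.single_le_sum (fun i _ => hG i) (mem_univ i)
      have a3 : (4 * n.choose 2 : ℤ) - 14 ≤ G i := by
        simp only [G]; omega
      exact a3.trans a2
    · push Not at h2
      have hpq : p ≠ q := by
        rintro rfl
        have := h2 p
        omega
      have a1 := h2 p (by omega)
      have a2 : (sl q E).card < 2 := by
        by_contra hc
        have := h2 q (by omega)
        omega
      have a3 : G p + G q ≤ ∑ i, G i := by
        rw [← Finset.sum_pair hpq]
        exact Finset.sum_le_sum_of_subset_of_nonneg (subset_univ _) (fun i _ _ => hG i)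
      have a4 := hx p q hpq
      have a5 : (4 * n.choose 2 : ℤ) - 14 ≤ G p + G q := by
        simp only [G]; omega
      exact a5.trans a3

lemma two_mul_choose (n : ℕ) : 2 * (n + 1).choose 2 = (n + 1) * n := by
  induction n with
  | zero => simp
  | succ n ih =>
    rw [Nat.choose_succ_succ' (n + 1) 1, Nat.choose_one_right, mul_add, ih]
    ring

lemma fact_big (n : ℕ) (hn : 5 ≤ n) : 4 * n.choose 2 ≤ n.factorial ∧ 10 ≤ n.choose 2 := by
  induction n, hn using Nat.le_induction with
  | base => decide
  | succ n hn ih =>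
    have h1 : (n + 1).choose 2 = n + n.choose 2 := by
      rw [Nat.choose_succ_succ' n 1, Nat.choose_one_right]
    rw [h1, Nat.factorial_succ, add_mul]
    have h2 : n * 40 ≤ n * n.factorial := Nat.mul_le_mul_left _ (by omega)
    omega

lemma parts_ge_two {n : ℕ} (X : Finset (Perm (Fin n))) (hX : X.Nonempty)
    (h : ∀ x ∈ X, 2 ≤ (nb x ∩ X).card) (s : ℤˣ) : 2 ≤ (X.filter (fun g => sign g = s)).card := by
  have key : ∀ x ∈ X, sign x = -s → 2 ≤ (X.filter (fun g => sign g = s)).card := by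
    intro x hx hs
    refine (h x hx).trans (card_le_card ?_)
    intro y hy
    rw [mem_inter] at hy
    rw [mem_filter]
    exact ⟨hy.2, by rw [sign_nb hy.1, hs, neg_neg]⟩
  obtain ⟨x, hx⟩ := hX
  by_cases hs : sign x = -s
  · exact key x hx hs
  · have hs' : sign x = s := by
      rcases Int.units_eq_one_or s with h | h <;>
      rcases Int.units_eq_one_or (sign x) with h' | h' <;> simp_all
    have h2 := h x hx
    obtain ⟨y, hy⟩ : (nb x ∩ X).Nonempty := card_pos.mp (by omega)
    rw [mem_inter] at hy
    exact key y hy.2 (by rw [sign_nb hy.1, hs'])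

lemma card_parts {n : ℕ} (X : Finset (Perm (Fin n))) :
    X.card = (X.filter (fun g => sign g = 1)).card + (X.filter (fun g => sign g = -1)).card := by
  rw [← card_filter_add_card_filter_not (s := X) (fun g => sign g = 1)]
  congr 2
  ext g
  simp only [mem_filter]
  refine and_congr_right fun _ => ?_
  rcases Int.units_eq_one_or (sign g) with h' | h' <;> rw [h'] <;> decide

lemma lower {n : ℕ} (hn : 5 ≤ n) (F : Set (Perm (Fin n)))
    (hF : IsRkCut (cayley {t : Perm (Fin n) | t.IsSwap}) 2 F) :
    4 * n.choose 2 ≤ F.ncard + 10 := by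
  classical
  obtain ⟨hd, hk⟩ := hF
  set Γ := cayley {t : Perm (Fin n) | t.IsSwap} with hΓ
  have hfb := fact_big n hn
  by_cases hne : (Fᶜ : Set (Perm (Fin n))).Nonempty
  swap
  · rw [Set.not_nonempty_iff_eq_empty, Set.compl_empty_iff] at hne
    rw [hne, Set.ncard_univ, Nat.card_eq_fintype_card, Fintype.card_perm, Fintype.card_fin]
    omega
  have hnp : ¬ (Γ.induce (Fᶜ : Set (Perm (Fin n)))).Preconnected := by
    intro hp
    have : Nonempty (Fᶜ : Set (Perm (Fin n))) := hne.to_subtype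
    exact hd ⟨hp⟩
  unfold SimpleGraph.Preconnected at hnp
  push Not at hnp
  obtain ⟨u, v, huv⟩ := hnp
  let A : Finset (Perm (Fin n)) :=
    univ.filter (fun x => ∃ hx : x ∈ Fᶜ, (Γ.induce Fᶜ).Reachable u ⟨x, hx⟩)
  let B : Finset (Perm (Fin n)) :=
    univ.filter (fun x => ∃ hx : x ∈ Fᶜ, ¬ (Γ.induce Fᶜ).Reachable u ⟨x, hx⟩)
  have step : ∀ x y, x ∈ A → y ∉ F → y ∈ nb x → y ∈ A := by
    intro x y hx hy hxy
    simp only [A, mem_filter, mem_univ, true_and] at hx ⊢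
    obtain ⟨hx, hr⟩ := hx
    refine ⟨hy, hr.trans (SimpleGraph.Adj.reachable ?_)⟩
    rw [SimpleGraph.comap_adj]
    exact (cayley_adj _ _).mpr hxy
  have hAF : ∀ x ∈ A, x ∉ F := by
    intro x hx
    simp only [A, mem_filter, mem_univ, true_and] at hx
    exact hx.1
  have hB : ∀ x, x ∈ B ↔ x ∉ F ∧ x ∉ A := by
    intro x
    simp only [A, B, mem_filter, mem_univ, true_and]
    constructor
    · rintro ⟨h1, h2⟩
      exact ⟨h1, fun ⟨_, h3⟩ => h2 h3⟩
    · rintro ⟨h1, h2⟩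
      exact ⟨h1, fun h3 => h2 ⟨h1, h3⟩⟩
  have hnad : ∀ x ∈ A, ∀ y ∈ B, y ∉ nb x := by
    intro x hx y hy hxy
    exact ((hB y).mp hy).2 (step x y hx ((hB y).mp hy).1 hxy)
  have hkk : ∀ x, x ∉ F → ∀ X : Finset (Perm (Fin n)), (∀ y, y ∉ F → y ∈ nb x → y ∈ X) →
      2 ≤ (nb x ∩ X).card := by
    intro x hx X hX
    refine (hk x hx).trans ?_
    rw [← Set.ncard_coe_finset]
    refine Set.ncard_le_ncard ?_ (Set.toFinite _)
    rintro y ⟨hy1, hy2⟩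
    have := (cayley_adj _ _).mp hy2
    simp only [coe_inter, Set.mem_inter_iff, mem_coe]
    exact ⟨this, hX y hy1 this⟩
  have hA2 := parts_ge_two A ⟨u, by
      simp only [A, mem_filter, mem_univ, true_and]
      exact ⟨u.2, SimpleGraph.Reachable.refl _⟩⟩
    (fun x hx => hkk x (hAF x hx) A (fun y hy hxy => step x y hx hy hxy))
  have hB2 := parts_ge_two B ⟨v, by
      simp only [B, mem_filter, mem_univ, true_and]
      exact ⟨v.2, huv⟩⟩
    (fun x hx => hkk x ((hB x).mp hx).1 B (fun y hy hxy => (hB y).mpr ⟨hy, fun hyA =>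
      ((hB x).mp hx).2 (step y x hyA ((hB x).mp hx).1 (mem_nb_comm.mp hxy))⟩))
  have hO : ∀ s : ℤˣ, Opp (A.filter (fun g => sign g = s)) (B.filter (fun g => sign g = -s)) := by
    intro s
    refine ⟨s, ?_, ?_, ?_⟩
    · intro g hg; exact (mem_filter.mp hg).2
    · intro g hg; exact (mem_filter.mp hg).2
    · intro g hg k hk
      exact hnad g (mem_filter.mp hg).1 k (mem_filter.mp hk).1
  have q1 := main_bound n (by omega) _ _ (hO 1) (hA2 1) (hB2 (-1))
  have q2 := main_bound n (by omega) _ _ (hO (-1)) (hA2 (-1)) (hB2 _)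
  rw [neg_neg] at q2
  have hcA := card_parts A
  have hcB := card_parts B
  have hAB : Disjoint A B := by
    rw [Finset.disjoint_left]
    intro x hx hx'
    exact ((hB x).mp hx').2 hx
  have htot : F.ncard + (A.card + B.card) = n.factorial := by
    have h1 : (Fᶜ : Set (Perm (Fin n))) = ((A ∪ B : Finset (Perm (Fin n))) : Set _) := by
      ext x
      simp only [Set.mem_compl_iff, coe_union, Set.mem_union, mem_coe]
      rw [hB]
      have := hAF x
      tauto
    have h2 := Set.ncard_add_ncard_compl F
    rw [h1, Set.ncard_coe_finset, card_union_of_disjoint hAB, Nat.card_eq_fintype_card,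
      Fintype.card_perm, Fintype.card_fin] at h2
    exact h2
  omega

set_option maxHeartbeats 1000000 in
lemma upper {n : ℕ} (hn : 5 ≤ n) : ∃ F : Set (Perm (Fin n)),
    IsRkCut (cayley {t : Perm (Fin n) | t.IsSwap}) 2 F ∧ F.ncard + 10 ≤ 4 * n.choose 2 := by
  classical
  have hfb := fact_big n hn
  let a : Fin n := ⟨0, by omega⟩
  let b : Fin n := ⟨1, by omega⟩
  let c : Fin n := ⟨2, by omega⟩
  have hab : a ≠ b := by simp [a, b]
  have hac : a ≠ c := by simp [a, c]
  have hbc : b ≠ c := by simp [b, c]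
  clear_value a b c
  obtain ⟨r, hr⟩ : ∃ r, r = swap a b * swap b c := ⟨_, rfl⟩
  obtain ⟨r', hr'⟩ : ∃ r', r' = swap b c * swap a b := ⟨_, rfl⟩
  have n1 : ∀ x y : Fin n, x ≠ y → swap x y ∈ nb (1 : Perm (Fin n)) := by
    intro x y h; rw [mem_nb]; exact ⟨x, y, h, by simp⟩
  have c1 : swap b c * (swap a b * swap b c) = swap a c := by
    rw [← mul_assoc, swap_mul_swap_mul_swap hab hac, swap_comm]
  have c2 : swap a b * (swap b c * swap a b) = swap a c := by
    have := swap_mul_swap_mul_swap (x := c) (y := b) (z := a) hbc.symm hac.symm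
    rw [swap_comm b a, swap_comm c b] at this
    rw [← mul_assoc, this]
  have r1 : swap a b ∈ nb r := by
    rw [mem_nb_comm, mem_nb]; exact ⟨b, c, hbc, by rw [hr]; simp [← mul_assoc]⟩
  have r2 : swap b c ∈ nb r := by
    rw [mem_nb_comm, mem_nb]; exact ⟨a, c, hac, by rw [hr, swap_inv, c1]⟩
  have r3 : swap a c ∈ nb r := by
    rw [mem_nb_comm, mem_nb]; exact ⟨a, b, hab, by
      rw [hr, swap_inv, ← c2]; simp only [mul_assoc]; simp [← mul_assoc]⟩
  have s1 : r' ∈ nb (swap a b) := by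
    rw [mem_nb]; exact ⟨a, c, hac, by rw [hr', swap_inv, c2]⟩
  have s2 : r' ∈ nb (swap b c) := by
    rw [mem_nb]; exact ⟨a, b, hab, by rw [hr']; simp [← mul_assoc]⟩
  have ne1 : swap a b ≠ swap b c := by
    intro h
    have := congrArg (fun f => f a) h
    simp [swap_apply_of_ne_of_ne hab hac] at this
    exact hab this.symm
  have ne2 : swap a b ≠ swap a c := by
    intro h
    have := congrArg (fun f => f a) h
    simp at this
    exact hbc this
  have ne3 : swap b c ≠ swap a c := by
    intro h
    have := congrArg (fun f => f a) h
    simp [swap_apply_of_ne_of_ne hab hac] at this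
    exact hac this
  have hrc : r c = a := by rw [hr]; simp
  have hr'c : r' c = b := by rw [hr']; simp [swap_apply_of_ne_of_ne hac.symm hbc.symm]
  have ne4 : r ≠ 1 := by
    intro h; rw [h] at hrc; exact hac hrc.symm
  have ne5 : r' ≠ 1 := by
    intro h; rw [h] at hr'c; exact hbc hr'c.symm
  have ne6 : r ≠ r' := by
    intro h; rw [h, hr'c] at hrc; exact hab hrc.symm
  have sr : sign r = 1 := by rw [hr, Perm.sign_mul, sign_swap hab, sign_swap hbc]; decide
  set t := swap a b with ht
  set t' := swap b c with ht'
  have st : sign t = -1 := sign_swap hab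
  have st' : sign t' = -1 := sign_swap hbc
  have m1 : (1 : Perm (Fin n)) ∈ nb t := mem_nb_comm.mp (n1 a b hab)
  have m2 : (1 : Perm (Fin n)) ∈ nb t' := mem_nb_comm.mp (n1 b c hbc)
  have m3 : r ∈ nb t := mem_nb_comm.mp r1
  have m4 : r ∈ nb t' := mem_nb_comm.mp r2
  have m5 : t ∈ nb 1 := n1 a b hab
  have m6 : t' ∈ nb 1 := n1 b c hbc
  have m7 : swap a c ∈ nb 1 := n1 a c hac
  clear n1 c1 c2
  clear_value t t'
  generalize swap a c = tt at *
  clear ht ht' hr hr'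
  have i1 : 3 ≤ (nb 1 ∩ nb r).card := by
    rw [← card_eq_three.mpr ⟨t, t', tt, ne1, ne2, ne3, rfl⟩]
    refine card_le_card ?_
    intro x hx
    simp only [mem_insert, mem_singleton] at hx
    rw [mem_inter]
    rcases hx with rfl | rfl | rfl
    exacts [⟨m5, r1⟩, ⟨m6, r2⟩, ⟨m7, r3⟩]
  have i2 : 3 ≤ (nb t ∩ nb t').card := by
    rw [← card_eq_three.mpr ⟨1, r, r', ne4.symm, ne5.symm, ne6, rfl⟩]
    refine card_le_card ?_
    intro x hx
    simp only [mem_insert, mem_singleton] at hx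
    rw [mem_inter]
    rcases hx with rfl | rfl | rfl
    exacts [⟨m1, m2⟩, ⟨m3, m4⟩, ⟨s1, s2⟩]
  have u1 := card_union_add_card_inter (nb 1) (nb r)
  have u2 := card_union_add_card_inter (nb t) (nb t')
  rw [card_nb, card_nb] at u1 u2
  obtain ⟨C, hC⟩ : ∃ C : Finset (Perm (Fin n)), C = {1, r, t, t'} := ⟨_, rfl⟩
  obtain ⟨N, hN⟩ : ∃ N : Finset (Perm (Fin n)), N = (nb 1 ∪ nb r) ∪ (nb t ∪ nb t') := ⟨_, rfl⟩
  have memN : ∀ x, x ∈ N ↔ ∃ y ∈ C, x ∈ nb y := by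
    intro x
    simp only [hN, hC, mem_union, mem_insert, mem_singleton, exists_eq_or_imp, exists_eq_left]
    tauto
  have hCN : C ⊆ N := by
    intro x hx
    rw [hC] at hx
    simp only [mem_insert, mem_singleton] at hx
    simp only [hN, mem_union]
    rcases hx with rfl | rfl | rfl | rfl
    · exact Or.inr (Or.inl m1)
    · exact Or.inr (Or.inl m3)
    · exact Or.inl (Or.inl m5)
    · exact Or.inl (Or.inl m6)
  have sne : ∀ x y : Perm (Fin n), sign x = 1 → sign y = -1 → x ≠ y := by
    rintro x y h1 h2 rfl
    rw [h1] at h2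
    exact absurd h2 (by decide)
  have hCc : C.card = 4 := by
    rw [hC, card_insert_of_notMem, card_eq_three.mpr ⟨r, t, t', sne _ _ sr st, sne _ _ sr st',
      ne1, rfl⟩]
    simp only [mem_insert, mem_singleton, not_or]
    exact ⟨ne4.symm, sne _ _ sign_one st, sne _ _ sign_one st'⟩
  have hNc : N.card + 6 ≤ 4 * n.choose 2 := by
    have := card_union_le (nb 1 ∪ nb r) (nb t ∪ nb t')
    rw [← hN] at this
    omega
  have memF : ∀ x, x ∉ ((N \ C : Finset (Perm (Fin n))) : Set (Perm (Fin n))) ↔ (x ∈ C ∨ x ∉ N) := by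
    intro x
    rw [mem_coe, mem_sdiff]
    tauto
  refine ⟨((N \ C : Finset (Perm (Fin n))) : Set (Perm (Fin n))), ⟨?_, ?_⟩, ?_⟩
  · intro hcon
    obtain ⟨x, hx⟩ : ∃ x, x ∉ N := by
      by_contra! hall
      have h1 : N = univ := by ext x; simp [hall x]
      rw [h1, card_univ, Fintype.card_perm, Fintype.card_fin] at hNc
      omega
    have h1C : (1 : Perm (Fin n)) ∈ C := by rw [hC]; simp
    have hreach := hcon.preconnected ⟨1, (memF 1).mpr (Or.inl h1C)⟩ ⟨x, (memF x).mpr (Or.inr hx)⟩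
    rw [SimpleGraph.reachable_iff_reflTransGen] at hreach
    have : ∀ y, Relation.ReflTransGen ((cayley {t : Perm (Fin n) | t.IsSwap}).induce
        (((N \ C : Finset (Perm (Fin n))) : Set (Perm (Fin n)))ᶜ)).Adj
        ⟨1, (memF 1).mpr (Or.inl h1C)⟩ y → y.1 ∈ C := by
      intro y hy
      induction hy with
      | refl => exact h1C
      | tail _ hyz ih =>
        rename_i y z _
        rw [SimpleGraph.comap_adj] at hyz
        have h2 := (cayley_adj _ _).mp hyz
        rcases (memF z.1).mp z.2 with h3 | h3
        · exact h3
        · exact absurd ((memN _).mpr ⟨_, ih, h2⟩) h3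
    exact hx (hCN (this _ hreach))
  · intro x hx
    have hset : {u | u ∉ ((N \ C : Finset (Perm (Fin n))) : Set (Perm (Fin n))) ∧
        (cayley {t : Perm (Fin n) | t.IsSwap}).Adj x u} = ((nb x \ (N \ C) : Finset _) : Set _) := by
      ext y
      simp only [Set.mem_ofPred_eq, cayley_adj, mem_coe, mem_sdiff]
      tauto
    rw [hset, Set.ncard_coe_finset]
    rcases (memF x).mp hx with hxC | hxN
    · have hsub : ∀ y z : Perm (Fin n), y ≠ z → y ∈ C → z ∈ C → y ∈ nb x → z ∈ nb x →
          2 ≤ (nb x \ (N \ C)).card := by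
        intro y z hyz hy hz hy' hz'
        rw [← card_pair hyz]
        refine card_le_card ?_
        intro w hw
        simp only [mem_insert, mem_singleton] at hw
        simp only [mem_sdiff]
        rcases hw with rfl | rfl
        · tauto
        · tauto
      have c1 : (1 : Perm (Fin n)) ∈ C := by rw [hC]; simp
      have c2 : r ∈ C := by rw [hC]; simp
      have c3 : t ∈ C := by rw [hC]; simp
      have c4 : t' ∈ C := by rw [hC]; simp
      rw [hC] at hxC
      simp only [mem_insert, mem_singleton] at hxC
      rcases hxC with rfl | rfl | rfl | rfl
      · exact hsub t t' ne1 c3 c4 m5 m6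
      · exact hsub t t' ne1 c3 c4 r1 r2
      · exact hsub 1 r ne4.symm c1 c2 m1 m3
      · exact hsub 1 r ne4.symm c1 c2 m2 m4
    · have hxC : ∀ y ∈ C, x ≠ y := by
        rintro y hy rfl
        exact hxN (hCN hy)
      have h6 : (nb x ∩ N).card ≤ 6 := by
        obtain ⟨y, z, hy, hz, hyz⟩ : ∃ y z, y ∈ C ∧ z ∈ C ∧
            nb x ∩ N ⊆ (nb x ∩ nb y) ∪ (nb x ∩ nb z) := by
          have c1 : (1 : Perm (Fin n)) ∈ C := by rw [hC]; simp
          have c2 : r ∈ C := by rw [hC]; simp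
          have c3 : t ∈ C := by rw [hC]; simp
          have c4 : t' ∈ C := by rw [hC]; simp
          have hsg : ∀ w y, w ∈ nb x → w ∈ nb y → sign x = sign y := by
            intro w y h1 h2
            have := sign_nb h1
            rw [sign_nb h2] at this
            exact (neg_injective this).symm
          rcases Int.units_eq_one_or (sign x) with hs | hs
          · refine ⟨1, r, c1, c2, ?_⟩
            intro w hw
            simp only [hN, mem_inter, mem_union] at hw ⊢
            obtain ⟨h1, (h2 | h2) | (h2 | h2)⟩ := hw
            · exact Or.inl ⟨h1, h2⟩
            · exact Or.inr ⟨h1, h2⟩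
            · have := hsg w _ h1 h2
              rw [hs, st] at this
              exact absurd this (by decide)
            · have := hsg w _ h1 h2
              rw [hs, st'] at this
              exact absurd this (by decide)
          · refine ⟨t, t', c3, c4, ?_⟩
            intro w hw
            simp only [hN, mem_inter, mem_union] at hw ⊢
            obtain ⟨h1, (h2 | h2) | (h2 | h2)⟩ := hw
            · have := hsg w _ h1 h2
              rw [hs, Perm.sign_one] at this
              exact absurd this (by decide)
            · have := hsg w _ h1 h2
              rw [hs, sr] at this
              exact absurd this (by decide)
            · exact Or.inl ⟨h1, h2⟩
            · exact Or.inr ⟨h1, h2⟩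
        have h1 := codeg (hxC y hy)
        have h2 := codeg (hxC z hz)
        have h3 := card_le_card hyz
        have h4 := card_union_le (nb x ∩ nb y) (nb x ∩ nb z)
        omega
      have h7 : (nb x \ N).card ≤ (nb x \ (N \ C)).card :=
        card_le_card (sdiff_subset_sdiff (subset_refl _) sdiff_subset)
      have h8 := card_sdiff_add_card_inter (nb x) N
      rw [card_nb] at h8
      omega
  · rw [Set.ncard_coe_finset]
    have := card_sdiff_add_card_eq_card hCN
    omega

/-- For `n ≥ 5`, the `R_2`-vertex-connectivity of the complete transposition graph
`CT_n` (the Cayley graph of the set of all transpositions of `Sym(n)`) equals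
`2n(n-1) - 10`. -/
theorem stmt15 (n : ℕ) (hn : 5 ≤ n) :
    rkConn (cayley {t : Equiv.Perm (Fin n) | t.IsSwap}) 2 = 2 * n * (n - 1) - 10 := by
  obtain ⟨F, hF, hc⟩ := upper hn
  have hl := lower hn F hF
  have h2 : 2 * n * (n - 1) = 4 * n.choose 2 := by
    obtain ⟨k, rfl⟩ : ∃ k, n = k + 1 := ⟨n - 1, by omega⟩
    have := two_mul_choose k
    rw [Nat.add_sub_cancel, mul_assoc, ← this]
    ring
  rw [h2]
  unfold rkConn
  apply le_antisymm
  · exact Nat.sInf_le ⟨F, hF, by omega⟩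
  · refine le_csInf ⟨_, F, hF, rfl⟩ ?_
    rintro m ⟨F', hF', rfl⟩
    have := lower hn F' hF'
    omega
end
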